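/- arXiv:1609.04005 — 3 statements merged into one kernel-verified Lean document; each statement's English description precedes it below -/
import Mathlib

section
/- There exists a perfect set E ⊆ 2^ω such that for every balanced perfect set B ⊆ 2^ω, either the μ_B-outer measure of E ∩ B is 0 or the μ_E-outer measure of B ∩ E is 0. -/
open MeasureTheory Set Pointwise

/-- The Cantor space `2^ω`, a compact topological group under coordinatewise
addition mod 2. -/
abbrev CS := ℕ → ZMod 2

/-- The basic clopen set `[w]` determined by a finite binary sequence `w`:
all `x ∈ 2^ω` extending `w`. -/
def cyl (w : List (ZMod 2)) : Set CS := {x | ∀ i, i < w.length → x i = w.getD i 0}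

/-- `w` is a branching node of `P`: both `[w⌢0] ∩ P` and `[w⌢1] ∩ P` are nonempty. -/
def Branch (P : Set CS) (w : List (ZMod 2)) : Prop :=
  (cyl (w ++ [0]) ∩ P).Nonempty ∧ (cyl (w ++ [1]) ∩ P).Nonempty

/-- A perfect subset of Cantor space: nonempty, closed, with no isolated points. -/
def PerfSet (P : Set CS) : Prop := Perfect P ∧ P.Nonempty

/-- `ν` is a canonical measure of the perfect set `P`: a Borel probability measure with
`ν P = 1` and `ν [w⌢0] = ν [w⌢1]` for every branching node `w` of `P`. -/
def IsCanonical (P : Set CS) (ν : Measure CS) : Prop :=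
  IsProbabilityMeasure ν ∧ ν P = 1 ∧
    ∀ w : List (ZMod 2), Branch P w → ν (cyl (w ++ [0])) = ν (cyl (w ++ [1]))

/-- `A` is `P`-null: the `μ_P`-outer measure of `A ∩ P` is `0`
(quantified over all canonical measures of `P`). -/
def PNull (P A : Set CS) : Prop := ∀ ν : Measure CS, IsCanonical P ν → ν (A ∩ P) = 0

/-- `A` is `P`-measurable: `A ∩ P` differs from a Borel set by a `P`-null set,
i.e. it is null-measurable with respect to the canonical measure of `P`. -/
def PMeasurable (P A : Set CS) : Prop :=
  ∀ ν : Measure CS, IsCanonical P ν → NullMeasurableSet (A ∩ P) ν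

/-- `X` is perfectly null: `P`-null for every perfect set `P`. -/
def PerfectlyNull (X : Set CS) : Prop := ∀ P, PerfSet P → PNull P X

/-- `μ` is the fair-coin (Lebesgue product) measure on `2^ω`:
a Borel probability measure with `μ [w] = 2^{-|w|}` for every finite binary sequence. -/
def IsFairCoin (μ : Measure CS) : Prop :=
  IsProbabilityMeasure μ ∧ ∀ w : List (ZMod 2), μ (cyl w) = (2 : ENNReal)⁻¹ ^ w.length

/-- The number of branching nodes of `P` that are proper initial segments of `v`. -/
noncomputable def brCount (P : Set CS) (v : List (ZMod 2)) : ℕ :=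
  Set.ncard {u : List (ZMod 2) | u <+: v ∧ u ≠ v ∧ Branch P u}

/-- A balanced perfect set: branching nodes of strictly smaller level
are strictly shorter. -/
def BalancedPerf (P : Set CS) : Prop :=
  PerfSet P ∧ ∀ v w : List (ZMod 2), Branch P v → Branch P w →
    brCount P v < brCount P w → v.length < w.length

/-- A uniformly perfect set: on each length, either all nodes meeting `P` branch,
or none does. -/
def UniformlyPerf (P : Set CS) : Prop :=
  PerfSet P ∧ ∀ n : ℕ,
    (∀ w : List (ZMod 2), w.length = n → (cyl w ∩ P).Nonempty → Branch P w) ∨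
    (∀ w : List (ZMod 2), w.length = n → ¬ Branch P w)

/-- A Silver perfect set: determined by a partial function `ℕ ⇀ 2`
whose domain has infinite complement. -/
def SilverPerf (P : Set CS) : Prop :=
  ∃ f : ℕ → Option (ZMod 2), {n | f n = none}.Infinite ∧
    P = {x | ∀ n b, f n = some b → x n = b}

/-- A Marczewski null (`s₀`) set. -/
def S0Set (X : Set CS) : Prop :=
  ∀ P, PerfSet P → ∃ Q, PerfSet Q ∧ Q ⊆ P ∧ Q ∩ X = ∅

/-- `S` is a Sierpiński set with respect to the measure `μ`: uncountable, with
countable intersection with every `μ`-null set. -/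
def Sierpinski (μ : Measure CS) (S : Set CS) : Prop :=
  ¬ S.Countable ∧ ∀ N : Set CS, μ N = 0 → (S ∩ N).Countable

/-- The interleaving homeomorphism `h : 2^ω × 2^ω → 2^ω`,
`h(x,y) = ⟨x 0, y 0, x 1, y 1, …⟩`. -/
def interleave (p : CS × CS) : CS := fun n => if n % 2 = 0 then p.1 (n / 2) else p.2 (n / 2)

/-- `X` is universally null: outer measure zero with respect to every finite diffused
Borel measure on `2^ω`. -/
def UniversallyNull (X : Set CS) : Prop :=
  ∀ μ : Measure CS, IsFiniteMeasure μ → (∀ x : CS, μ {x} = 0) → μ X = 0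

/-- `X` is strongly null: for every sequence of positive `ε n` there are sets `A n` of
diameter `< ε n` (with respect to the standard metric `d(x,y) = 2^{-min{n : x n ≠ y n}}`,
expressed combinatorially) covering `X`. -/
def StronglyNull (X : Set CS) : Prop :=
  ∀ ε : ℕ → ℝ, (∀ n, 0 < ε n) → ∃ A : ℕ → Set CS,
    (∀ n, ∃ N : ℕ, (2 : ℝ)⁻¹ ^ N < ε n ∧ ∀ x ∈ A n, ∀ y ∈ A n, ∀ i < N, x i = y i) ∧
    X ⊆ ⋃ n, A n

/-- `X` is perfectly null in the transitive sense: for every perfect `P` there is a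
`G_δ` set `G ⊇ X` with `(G + t) ∩ P` being `P`-null for every `t`. -/
def PNPrime (X : Set CS) : Prop :=
  ∀ P, PerfSet P → ∃ G : Set CS, IsGδ G ∧ X ⊆ G ∧
    ∀ t : CS, PNull P ((fun g => g + t) '' G)


/-- points agreeing with `x` below `k` -/
def C (x : CS) (k : ℕ) : Set CS := {y | ∀ i, i < k → y i = x i}

def pre (x : CS) (k : ℕ) : List (ZMod 2) := (List.range k).map x

def Br (P : Set CS) (x : CS) (k : ℕ) : Prop :=
  ∀ b : ZMod 2, ∃ y ∈ P, y ∈ C x k ∧ y k = b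

lemma length_pre (x : CS) (k : ℕ) : (pre x k).length = k := by simp [pre]

lemma cyl_pre (x : CS) (k : ℕ) : cyl (pre x k) = C x k := by
  ext y
  simp only [cyl, C, mem_setOf_eq, length_pre]
  refine forall_congr' fun i => forall_congr' fun hi => ?_
  simp [pre, List.getD, hi]

lemma cyl_pre_append (x : CS) (k : ℕ) (b : ZMod 2) :
    cyl (pre x k ++ [b]) = C x k ∩ {y | y k = b} := by
  ext y
  simp only [cyl, C, mem_setOf_eq, mem_inter_iff, List.length_append, length_pre,
    List.length_singleton]
  constructor
  · intro h
    refine ⟨fun i hi => ?_, ?_⟩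
    · have := h i (by omega)
      rw [List.getD_append _ _ _ _ (by simpa [length_pre] using hi)] at this
      simpa [pre, List.getD, hi] using this
    · have := h k (by omega)
      rw [List.getD_append_right _ _ _ _ (by simp [length_pre])] at this
      simpa [length_pre] using this
  · rintro ⟨h1, h2⟩ i hi
    rcases Nat.lt_succ_iff_lt_or_eq.1 hi with h | h
    · rw [List.getD_append _ _ _ _ (by simpa [length_pre] using h)]
      simpa [pre, List.getD, h] using h1 i h
    · subst h
      rw [List.getD_append_right _ _ _ _ (by simp [length_pre])]
      simpa [length_pre] using h2

lemma zmod2 (b : ZMod 2) : b = 0 ∨ b = 1 := by revert b; decide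

lemma branch_pre (P : Set CS) (x : CS) (k : ℕ) : Branch P (pre x k) ↔ Br P x k := by
  unfold Branch Br
  rw [cyl_pre_append, cyl_pre_append]
  constructor
  · rintro ⟨⟨y, ⟨h1, h2⟩, h3⟩, ⟨z, ⟨h4, h5⟩, h6⟩⟩ b
    rcases zmod2 b with rfl | rfl
    · exact ⟨y, h3, h1, h2⟩
    · exact ⟨z, h6, h4, h5⟩
  · intro h
    obtain ⟨y, h1, h2, h3⟩ := h 0
    obtain ⟨z, h4, h5, h6⟩ := h 1
    exact ⟨⟨y, ⟨h2, h3⟩, h1⟩, ⟨z, ⟨h5, h6⟩, h4⟩⟩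

lemma C_eq {x y : CS} {k : ℕ} (h : y ∈ C x k) : C y k = C x k := by
  ext z
  exact forall_congr' fun i => forall_congr' fun hi => by rw [h i hi]

lemma C_mono (x : CS) {k l : ℕ} (h : k ≤ l) : C x l ⊆ C x k :=
  fun _ hy i hi => hy i (by omega)

lemma mem_C (x : CS) (k : ℕ) : x ∈ C x k := fun _ _ => rfl

lemma Br_congr (P : Set CS) {x y : CS} {k : ℕ} (h : y ∈ C x k) : Br P y k ↔ Br P x k := by
  unfold Br; rw [C_eq h]

lemma C_succ (x : CS) (k : ℕ) : C x (k+1) = C x k ∩ {y | y k = x k} := by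
  ext y
  constructor
  · intro h; exact ⟨C_mono x (Nat.le_succ k) h, h k (by omega)⟩
  · rintro ⟨h1, h2⟩ i hi
    rcases Nat.lt_succ_iff_lt_or_eq.1 hi with h | h
    · exact h1 i h
    · subst h; exact h2

/-- child of the node -/
def ch (x : CS) (k : ℕ) (b : ZMod 2) : CS := Function.update x k b

lemma C_ch (x : CS) (k : ℕ) (b : ZMod 2) : C (ch x k b) (k+1) = C x k ∩ {y | y k = b} := by
  rw [C_succ]
  have : C (ch x k b) k = C x k := by
    symm; apply C_eq
    intro i hi
    simp [ch, Function.update_of_ne (show i ≠ k by omega)]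
  rw [this]; simp [ch]

lemma C_split (x : CS) (k : ℕ) : C x k = C (ch x k 0) (k+1) ∪ C (ch x k 1) (k+1) := by
  rw [C_ch, C_ch]
  ext y
  have := zmod2 (y k)
  simp only [mem_union, mem_inter_iff, mem_setOf_eq]
  tauto

lemma C_meas (x : CS) (k : ℕ) : MeasurableSet (C x k) := by
  have : C x k = ⋂ i, ⋂ (_ : i < k), (fun y : CS => y i) ⁻¹' {x i} := by
    ext y; simp [C]
  rw [this]
  exact MeasurableSet.iInter fun i => MeasurableSet.iInter fun _ =>
    measurable_pi_apply i (MeasurableSet.singleton _)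

lemma meas_split (ν : Measure CS) (x : CS) (k : ℕ) :
    ν (C x k) = ν (C (ch x k 0) (k+1)) + ν (C (ch x k 1) (k+1)) := by
  conv_lhs => rw [C_split]
  apply measure_union _ (C_meas _ _)
  rw [C_ch, C_ch, Set.disjoint_left]
  rintro y ⟨_, h⟩ ⟨_, h'⟩
  simp only [mem_setOf_eq] at h h'
  rw [h] at h'; exact absurd h' (by decide)

lemma outer_split (ν : Measure CS) (A : Set CS) (x : CS) (k : ℕ) :
    ν (A ∩ C x k) ≤ ν (A ∩ C (ch x k 0) (k+1)) + ν (A ∩ C (ch x k 1) (k+1)) := by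
  conv_lhs => rw [C_split, inter_union_distrib_left]
  exact measure_union_le _ _

lemma canon_half {P : Set CS} {ν : Measure CS} (h : IsCanonical P ν) {x : CS} {k : ℕ}
    (hb : Br P x k) (b : ZMod 2) : 2 * ν (C (ch x k b) (k+1)) = ν (C x k) := by
  have := h.2.2 (pre x k) ((branch_pre P x k).2 hb)
  rw [cyl_pre_append, cyl_pre_append, ← C_ch, ← C_ch] at this
  rw [meas_split ν x k, two_mul]
  rcases zmod2 b with rfl | rfl
  · rw [this]
  · rw [this]

lemma descent (ν : Measure CS) (A : Set CS) (c : ENNReal) (k d : ℕ)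
    (h : ∀ y, ν (A ∩ C y (k+d)) ≤ c * ν (C y (k+d))) : ∀ y, ν (A ∩ C y k) ≤ c * ν (C y k) := by
  induction d with
  | zero => exact h
  | succ d ih =>
    apply ih
    intro y
    refine (outer_split ν A y _).trans ?_
    rw [meas_split, mul_add]
    exact add_le_add (h _) (h _)

open Classical in
/-- number of branchings of `P` along `x` below `k` -/
noncomputable def cnt (P : Set CS) (x : CS) (k : ℕ) : ℕ := Nat.count (Br P x) k

lemma cnt_succ_of {P : Set CS} {x : CS} {k : ℕ} (h : Br P x k) :
    cnt P x (k+1) = cnt P x k + 1 := by simp [cnt, Nat.count_succ, h]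

lemma cnt_succ_of_not {P : Set CS} {x : CS} {k : ℕ} (h : ¬ Br P x k) :
    cnt P x (k+1) = cnt P x k := by simp [cnt, Nat.count_succ, h]

lemma cnt_mono (P : Set CS) (x : CS) {k l : ℕ} (h : k ≤ l) : cnt P x k ≤ cnt P x l := by
  classical
  unfold cnt
  exact Nat.count_monotone _ h

lemma cnt_congr {P : Set CS} {x y : CS} {k : ℕ} (h : y ∈ C x k) : cnt P y k = cnt P x k := by
  induction k with
  | zero => simp only [cnt, Nat.count_zero]
  | succ k ih =>
    have h' := C_mono x (Nat.le_succ k) h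
    by_cases hb : Br P x k
    · rw [cnt_succ_of hb, cnt_succ_of ((Br_congr P h').2 hb), ih h']
    · rw [cnt_succ_of_not hb, cnt_succ_of_not (fun h => hb ((Br_congr P h').1 h)), ih h']

lemma pre_inj {x : CS} {i j : ℕ} (h : pre x i = pre x j) : i = j := by
  rw [← length_pre x i, h, length_pre]

lemma prefix_pre {x : CS} {k : ℕ} {u : List (ZMod 2)} (h : u <+: pre x k) :
    u = pre x u.length := by
  have hl : u.length ≤ k := by simpa [length_pre] using h.length_le
  rw [List.prefix_iff_eq_take] at h
  conv_lhs => rw [h]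
  simp [pre, ← List.map_take, List.take_range, hl]

lemma pre_prefix (x : CS) {i k : ℕ} (h : i ≤ k) : pre x i <+: pre x k := by
  rw [List.prefix_iff_eq_take]
  simp [pre, ← List.map_take, List.take_range, h]

lemma brCount_pre (P : Set CS) (x : CS) (k : ℕ) : brCount P (pre x k) = cnt P x k := by
  classical
  unfold brCount cnt
  have : {u : List (ZMod 2) | u <+: pre x k ∧ u ≠ pre x k ∧ Branch P u} =
      pre x '' ((Finset.range k).filter (fun i => Br P x i) : Finset ℕ) := by
    ext u
    simp only [mem_setOf_eq, mem_image, Finset.coe_filter, Finset.mem_range]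
    constructor
    · rintro ⟨h1, h2, h3⟩
      have he := prefix_pre h1
      have hl : u.length ≤ k := by simpa [length_pre] using h1.length_le
      refine ⟨u.length, ⟨lt_of_le_of_ne hl ?_, ?_⟩, he.symm⟩
      · intro h; rw [h] at he; exact h2 he
      · rw [he] at h3; exact (branch_pre P x _).1 h3
    · rintro ⟨i, ⟨h1, h2⟩, rfl⟩
      exact ⟨pre_prefix x h1.le, fun h => by have := pre_inj h; omega, (branch_pre P x i).2 h2⟩
  rw [this, Set.ncard_image_of_injective _ (fun i j h => pre_inj h), Set.ncard_coe_finset,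
    Nat.count_eq_card_filter_range]

lemma exists_cnt {P : Set CS} {x : CS} {k c : ℕ} (h : c < cnt P x k) :
    ∃ i < k, Br P x i ∧ cnt P x i = c := by
  induction k with
  | zero => simp [cnt] at h
  | succ k ih =>
    by_cases hb : Br P x k
    · rw [cnt_succ_of hb] at h
      rcases Nat.lt_succ_iff_lt_or_eq.1 h with h | h
      · obtain ⟨i, hi, h⟩ := ih h
        exact ⟨i, by omega, h⟩
      · exact ⟨k, by omega, hb, h.symm⟩
    · rw [cnt_succ_of_not hb] at h
      obtain ⟨i, hi, h⟩ := ih h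
      exact ⟨i, by omega, h⟩

lemma C_nhds (x : CS) (k : ℕ) : C x k ∈ nhds x := by
  have : IsOpen (C x k) := by
    have : C x k = (Set.pi (Finset.range k : Set ℕ) fun i => {x i}) := by
      ext y; simp [C, Set.pi]
    rw [this]
    exact isOpen_set_pi (Finset.finite_toSet _) fun i _ => isOpen_discrete _
  exact this.mem_nhds (mem_C x k)

lemma exists_Br {P : Set CS} (hP : Perfect P) {x : CS} (hx : x ∈ P) (k : ℕ) :
    ∃ i ≥ k, Br P x i := by
  have h := (preperfect_iff_nhds.1 hP.acc) x hx (C x k) (C_nhds x k)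
  obtain ⟨y, ⟨hy1, hy2⟩, hne⟩ := h
  have hex : ∃ i, y i ≠ x i := by
    by_contra h; push Not at h; exact hne (funext h)
  classical
  refine ⟨Nat.find hex, ?_, ?_⟩
  · by_contra hlt
    exact Nat.find_spec hex (hy1 _ (by omega))
  · have hyC : y ∈ C x (Nat.find hex) := fun i hi => by
      have := Nat.find_min hex hi
      simpa using this
    have hs := Nat.find_spec hex
    intro b
    by_cases hb : x (Nat.find hex) = b
    · exact ⟨x, hx, mem_C _ _, hb⟩
    · refine ⟨y, hy2, hyC, ?_⟩
      revert hs hb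
      generalize y (Nat.find hex) = p
      generalize x (Nat.find hex) = q
      revert p q b
      decide

lemma exists_Br_cnt {P : Set CS} (hP : Perfect P) {x : CS} (hx : x ∈ P) (k : ℕ) :
    ∃ i ≥ k, Br P x i ∧ cnt P x i = cnt P x k := by
  classical
  have hex := exists_Br hP hx k
  obtain ⟨h1, h2⟩ := Nat.find_spec hex
  refine ⟨Nat.find hex, h1, h2, ?_⟩
  have key : ∀ j, k ≤ j → j ≤ Nat.find hex → cnt P x j = cnt P x k := by
    intro j hj
    induction j, hj using Nat.le_induction with
    | base => intro _; rfl
    | succ j hj ih =>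
      intro hl
      rw [cnt_succ_of_not, ih (by omega)]
      intro hb
      exact Nat.find_min hex (m := j) (by omega) ⟨hj, hb⟩
  exact key _ h1 le_rfl

lemma balanced_cnt {B : Set CS} (hB : BalancedPerf B) {x y : CS} (hx : x ∈ B)
    (t : ℕ) : cnt B y t ≤ cnt B x t + 1 := by
  by_contra hlt
  obtain ⟨i, hi, hbi, hci⟩ := exists_Br_cnt hB.1.1 hx t
  obtain ⟨j, hj, hbj, hcj⟩ := exists_cnt (P := B) (x := y) (k := t) (c := cnt B x t + 1) (by omega)
  have := hB.2 (pre x i) (pre y j) ((branch_pre _ _ _).2 hbi) ((branch_pre _ _ _).2 hbj)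
    (by rw [brCount_pre, brCount_pre]; omega)
  rw [length_pre, length_pre] at this
  omega

lemma cnt_unbounded {P : Set CS} (hP : Perfect P) {x : CS} (hx : x ∈ P) (M : ℕ) :
    ∃ k, M ≤ cnt P x k := by
  induction M with
  | zero => exact ⟨0, by omega⟩
  | succ M ih =>
    obtain ⟨k, hk⟩ := ih
    obtain ⟨i, hi, hb, hc⟩ := exists_Br_cnt hP hx k
    exact ⟨i+1, by rw [cnt_succ_of hb]; omega⟩

lemma ch_self_mem (x : CS) (k : ℕ) : ch x k (x k) = x := by simp [ch]

lemma meas_cnt {B : Set CS} {ρ : Measure CS} (h : IsCanonical B ρ) (z : CS) {s t : ℕ}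
    (hst : s ≤ t) : ρ (C z t) * 2 ^ cnt B z t ≤ ρ (C z s) * 2 ^ cnt B z s := by
  induction t, hst using Nat.le_induction with
  | base => exact le_rfl
  | succ t hj ih =>
    refine le_trans ?_ ih
    by_cases hb : Br B z t
    · rw [cnt_succ_of hb, ← canon_half h hb (z t), ch_self_mem, pow_succ]
      apply le_of_eq; ring
    · rw [cnt_succ_of_not hb]
      gcongr
      exact C_mono _ (by omega)

lemma main_upper {E B A : Set CS} {ν : Measure CS} (h : IsCanonical E ν) (hAB : A ⊆ B) (r : ℕ) :
    ∀ (s j : ℕ) (y : CS),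
    (∀ z ∈ A ∩ C y s, ∀ i, s ≤ i → i < s + r → Br E z i) →
    (∀ z ∈ A ∩ C y s, cnt B z (s + r) ≤ cnt B z s + j) →
    ν (A ∩ C y s) * 2 ^ r ≤ 2 ^ j * ν (C y s) := by
  induction r with
  | zero =>
    intro s j y _ _
    have h1 : (1 : ENNReal) ≤ 2 ^ j := one_le_pow₀ (by norm_num)
    calc ν (A ∩ C y s) * 2 ^ 0 = 1 * ν (A ∩ C y s) := by simp
      _ ≤ 2 ^ j * ν (C y s) := mul_le_mul' h1 (measure_mono inter_subset_right)
  | succ r ih =>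
    intro s j y hE hc
    rcases (A ∩ C y s).eq_empty_or_nonempty with he | ⟨z, hzA, hz⟩
    · rw [he]; simp
    rw [← C_eq hz] at hE hc ⊢
    have hbE : Br E z s := hE z ⟨hzA, mem_C _ _⟩ s le_rfl (by omega)
    have hsub : ∀ b, C (ch z s b) (s+1) ⊆ C z s := fun b => by
      rw [C_ch]; exact inter_subset_left
    have hE' : ∀ b, ∀ z' ∈ A ∩ C (ch z s b) (s+1), ∀ i, s + 1 ≤ i → i < s + 1 + r → Br E z' i :=
      fun b z' hz' i h1 h2 => hE z' ⟨hz'.1, hsub b hz'.2⟩ i (by omega) (by omega)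
    by_cases hb : Br B z s
    · have hj : 1 ≤ j := by
        have h1 := hc z ⟨hzA, mem_C _ _⟩
        have h2 := cnt_mono B z (show s + 1 ≤ s + (r+1) by omega)
        rw [cnt_succ_of hb] at h2
        omega
      obtain ⟨j, rfl⟩ : ∃ j', j = j' + 1 := ⟨j - 1, by omega⟩
      have key : ∀ b, ν (A ∩ C (ch z s b) (s+1)) * 2 ^ r ≤ 2 ^ j * ν (C (ch z s b) (s+1)) := by
        intro b
        apply ih _ _ _ (hE' b)
        intro z' hz'
        have h1 := hc z' ⟨hz'.1, hsub b hz'.2⟩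
        rw [cnt_succ_of ((Br_congr B (hsub b hz'.2)).2 hb)]
        rw [show s + 1 + r = s + (r+1) by ring]
        omega
      calc ν (A ∩ C z s) * 2 ^ (r+1)
          ≤ (ν (A ∩ C (ch z s 0) (s+1)) + ν (A ∩ C (ch z s 1) (s+1))) * 2 ^ (r+1) := by
            gcongr; exact outer_split _ _ _ _
        _ = (ν (A ∩ C (ch z s 0) (s+1)) * 2 ^ r + ν (A ∩ C (ch z s 1) (s+1)) * 2 ^ r) * 2 := by
            ring
        _ ≤ (2 ^ j * ν (C (ch z s 0) (s+1)) + 2 ^ j * ν (C (ch z s 1) (s+1))) * 2 := by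
            exact mul_le_mul_left (add_le_add (key 0) (key 1)) 2
        _ = 2 ^ (j+1) * ν (C z s) := by rw [meas_split ν z s]; ring
    · -- one child misses `B`
      have : ∃ b, A ∩ C z s ⊆ A ∩ C (ch z s b) (s+1) := by
        refine ⟨z s, fun z' hz' => ⟨hz'.1, ?_⟩⟩
        rw [C_ch]
        refine ⟨hz'.2, ?_⟩
        by_contra hne
        apply hb
        intro b
        by_cases hbz : z s = b
        · exact ⟨z, hAB hzA, mem_C _ _, hbz⟩
        · refine ⟨z', hAB hz'.1, hz'.2, ?_⟩
          simp only [mem_setOf_eq] at hne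
          revert hne hbz
          generalize z s = p
          generalize z' s = q
          revert p q b
          decide
      obtain ⟨b, hb'⟩ := this
      have key : ν (A ∩ C (ch z s b) (s+1)) * 2 ^ r ≤ 2 ^ j * ν (C (ch z s b) (s+1)) := by
        apply ih _ _ _ (hE' b)
        intro z' hz'
        have h1 := hc z' ⟨hz'.1, hsub b hz'.2⟩
        rw [cnt_succ_of_not (fun h => hb ((Br_congr B (hsub b hz'.2)).1 h))]
        rw [show s + 1 + r = s + (r+1) by ring]
        exact h1
      calc ν (A ∩ C z s) * 2 ^ (r+1)
          ≤ ν (A ∩ C (ch z s b) (s+1)) * 2 ^ (r+1) := by gcongr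
        _ = (ν (A ∩ C (ch z s b) (s+1)) * 2 ^ r) * 2 := by ring
        _ ≤ (2 ^ j * ν (C (ch z s b) (s+1))) * 2 := by gcongr
        _ = 2 ^ j * ν (C z s) := by rw [← canon_half h hbE b]; ring

/-- enumeration of finite sequences, each one infinitely often -/
def enum (n : ℕ) : List (ZMod 2) :=
  ((Encodable.decode (n.unpair.1) : Option (List (Bool))).getD []).map (fun b => if b then 1 else 0)

lemma enum_exists (x : CS) (k N : ℕ) : ∃ n ≥ N, enum n = pre x k := by
  refine ⟨Nat.pair (Encodable.encode ((pre x k).map (fun a => decide (a = 1)))) N,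
    Nat.right_le_pair _ _, ?_⟩
  simp only [enum, Nat.unpair_pair, Encodable.encodek, Option.getD_some, List.map_map]
  conv_rhs => rw [← List.map_id (pre x k)]
  apply List.map_congr_left
  intro a _
  clear * - a
  revert a; decide

/-- the set -/
def EE : Set CS := {x | ∀ i, x i ≠ 0 →
  x ∈ cyl (enum (Nat.sqrt i)) ∧ (enum (Nat.sqrt i)).length ≤ i}

lemma EE_flip {x : CS} (hx : x ∈ EE) {i k : ℕ} (hk : k ≤ i) (he : enum (Nat.sqrt i) = pre x k)
    (b : ZMod 2) : (fun j => if j < i then x j else if j = i then b else 0) ∈ EE := by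
  intro j hj
  have hC : (fun j => if j < i then x j else if j = i then b else 0) ∈ C x i := by
    intro l hl; simp [hl]
  rcases lt_trichotomy j i with h | h | h
  · simp only [h, if_true] at hj
    obtain ⟨h1, h2⟩ := hx j hj
    refine ⟨fun l hl => ?_, h2⟩
    rw [← h1 l hl]
    exact hC l (by omega)
  · subst h
    rw [he, cyl_pre, length_pre]
    exact ⟨C_mono x hk hC, hk⟩
  · simp [show ¬ j < i by omega, show j ≠ i by omega] at hj

lemma EE_Br {x : CS} (hx : x ∈ EE) {i k : ℕ} (hk : k ≤ i) (he : enum (Nat.sqrt i) = pre x k) :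
    Br EE x i := fun b =>
  ⟨_, EE_flip hx hk he b, fun l hl => by simp [hl], by simp⟩

lemma EE_closed : IsClosed EE := by
  have : EE = ⋂ i, ({x : CS | x i = 0} ∪
      {x | x ∈ cyl (enum (Nat.sqrt i)) ∧ (enum (Nat.sqrt i)).length ≤ i}) := by
    ext x
    simp only [EE, mem_setOf_eq, mem_iInter, mem_union]
    exact forall_congr' fun i => by tauto
  rw [this]
  refine isClosed_iInter fun i => IsClosed.union ?_ ?_
  · exact isClosed_eq (continuous_apply i) continuous_const
  · refine IsClosed.and ?_ isClosed_const
    unfold cyl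
    simp only [mem_setOf_eq, setOf_forall]
    exact isClosed_iInter fun j => isClosed_iInter fun _ =>
      isClosed_eq (continuous_apply j) continuous_const

lemma exists_C_subset {x : CS} {U : Set CS} (hU : U ∈ nhds x) : ∃ k, C x k ⊆ U := by
  rw [nhds_pi, Filter.mem_pi] at hU
  obtain ⟨I, hI, t, ht, hs⟩ := hU
  obtain ⟨N, hN⟩ := hI.bddAbove
  refine ⟨N+1, fun y hy => hs fun i hi => ?_⟩
  rw [hy i (Nat.lt_succ_of_le (hN hi))]
  exact mem_of_mem_nhds (ht i)

lemma EE_perf : PerfSet EE := by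
  refine ⟨⟨EE_closed, ?_⟩, ⟨0, fun i hi => absurd rfl hi⟩⟩
  rw [preperfect_iff_nhds]
  intro x hx U hU
  obtain ⟨k, hk⟩ := exists_C_subset hU
  obtain ⟨n, hn, he⟩ := enum_exists x k k
  have hkn : k ≤ n * n := hn.trans (Nat.le_mul_self n)
  obtain ⟨y, hyE, hyC, hy⟩ := EE_Br hx (i := n * n) hkn (by rw [Nat.sqrt_eq, he]) (x (n*n) + 1)
  refine ⟨y, ⟨hk (C_mono x hkn hyC), hyE⟩, ?_⟩
  rintro rfl
  revert hy
  generalize y (n*n) = p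
  revert p; decide

lemma sqrt_of {n i : ℕ} (h1 : n * n ≤ i) (h2 : i < n * n + (2 * n + 1)) : Nat.sqrt i = n := by
  have h3 : i < (n+1)*(n+1) := by nlinarith
  exact le_antisymm (Nat.lt_succ_iff.1 (Nat.sqrt_lt.2 h3)) (Nat.le_sqrt.2 h1)

/-- existence of a burst -/
lemma burst {B : Set CS} {ν : Measure CS} (h : IsCanonical EE ν) (hpos : ν (B ∩ EE) ≠ 0) (k N : ℕ) :
    ∃ n ≥ N, k ≤ n ∧ ∃ z ∈ B, enum n = pre z k ∧
      cnt B z (n * n) + n < cnt B z (n * n + (2 * n + 1)) := by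
  have := h.1
  have hfin : ν (B ∩ EE) ≠ ⊤ := measure_ne_top _ _
  set δ := ν (B ∩ EE) with hδ
  have h1 : ∃ x, δ / 2 * ν (C x k) < ν ((B ∩ EE) ∩ C x k) := by
    by_contra hcon
    push Not at hcon
    have := descent ν (B ∩ EE) (δ/2) 0 k (by simpa using hcon) 0
    have hu : C (0 : CS) 0 = univ := by ext; simp [C]
    rw [hu, inter_univ, measure_univ, mul_one] at this
    exact absurd this (not_le.2 (ENNReal.half_lt_self hpos hfin))
  obtain ⟨x, hx⟩ := h1
  obtain ⟨m, hm⟩ : ∃ m : ℕ, (2⁻¹ : ENNReal) ^ m < δ / 2 := by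
    apply ENNReal.exists_inv_two_pow_lt
    simpa using hpos
  obtain ⟨n, hn, he⟩ := enum_exists x k (N + k + m)
  by_contra hcon
  push Not at hcon
  have hcon := hcon n (by omega) (by omega)
  have hkn : k ≤ n * n := (show k ≤ n by omega).trans (Nat.le_mul_self n)
  set A := (B ∩ EE) ∩ C x k with hA
  have hpx : ∀ z ∈ C x k, pre z k = pre x k := by
    intro z hz
    apply List.map_congr_left
    intro i hi
    exact hz i (by simpa using hi)
  have key : ∀ y, ν (A ∩ C y (n * n)) ≤ (2⁻¹ : ENNReal) ^ (n+1) * ν (C y (n * n)) := by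
    intro y
    have := main_upper (A := A) (B := B) h (fun z hz => hz.1.1) (2 * n + 1) (n * n) n y
      (fun z hz i h1 h2 => EE_Br hz.1.1.2 (k := k) (by omega)
        (by rw [sqrt_of h1 h2, he, hpx z hz.1.2]))
      (fun z hz => hcon z hz.1.1.1 (by rw [he, hpx z hz.1.2]))
    have e : (2 : ENNReal) ^ (2 * n + 1) = 2 ^ n * 2 ^ (n+1) := by ring
    rw [e, mul_comm, mul_assoc] at this
    rw [ENNReal.mul_le_mul_iff_right (by simp) (by simp)] at this
    rw [← ENNReal.inv_pow, ← ENNReal.div_eq_inv_mul, ENNReal.le_div_iff_mul_le (by simp) (by simp), mul_comm]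
    exact this
  obtain ⟨d, hd⟩ := Nat.exists_eq_add_of_le hkn
  have h2 := descent ν A _ k d (by rw [← hd]; exact key) x
  have h3 : A ∩ C x k = A := by rw [hA, inter_assoc, inter_self]
  rw [h3] at h2
  have h4 : (2⁻¹ : ENNReal) ^ (n+1) ≤ δ / 2 :=
    (pow_le_pow_of_le_one (by simp) (by simp) (by omega)).trans hm.le
  exact absurd (hx.trans_le h2) (not_lt.2 (by gcongr))

lemma final {B : Set CS} (hB : BalancedPerf B) {ν ρ : Measure CS} (h : IsCanonical EE ν)
    (hρ : IsCanonical B ρ) (hpos : ν (B ∩ EE) ≠ 0) (M : ℕ) :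
    ρ (EE ∩ B) ≤ 2 * (2⁻¹ : ENNReal) ^ M := by
  have := hρ.1
  have le_inv : ∀ (a b : ENNReal) (c : ℕ), M ≤ c → a * 2 ^ c ≤ b → a ≤ 2⁻¹ ^ M * b := by
    intro a b c hc hab
    rw [← ENNReal.inv_pow, ← ENNReal.div_eq_inv_mul, ENNReal.le_div_iff_mul_le (by simp) (by simp)]
    refine le_trans ?_ hab
    gcongr
    norm_num
  obtain ⟨x₀, hx₀⟩ := hB.1.2
  obtain ⟨k, hk⟩ := cnt_unbounded hB.1.1 hx₀ (M+1)
  obtain ⟨n, hn, hkn, z, hzB, he, hc⟩ := burst h hpos k (M+2)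
  have hkn' : k ≤ n * n := hkn.trans (Nat.le_mul_self n)
  have h1 : ρ (C z k) ≤ 2⁻¹ ^ M := by
    have := meas_cnt hρ z (Nat.zero_le k)
    have h2 := balanced_cnt hB (y := x₀) hzB k
    have h3 := le_inv _ _ _ (show M ≤ cnt B z k by omega) this
    refine h3.trans ?_
    have : ρ (C z 0) ≤ 1 := prob_le_one
    simpa [cnt] using mul_le_mul_right this _
  have h2 : ∀ y, ρ (((EE ∩ B) \ C z k) ∩ C y (n*n)) ≤ 2⁻¹ ^ M * ρ (C y (n * n)) := by
    intro y
    rcases (((EE ∩ B) \ C z k) ∩ C y (n*n)).eq_empty_or_nonempty with hemp | ⟨u, ⟨⟨huE, huB⟩, huz⟩, huy⟩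
    · rw [hemp]; simp
    rw [← C_eq huy]
    have hzero : ∀ v ∈ EE, v ∉ C z k → ∀ i, n * n ≤ i → i < n * n + (2 * n + 1) → v i = 0 := by
      intro v hv hvz i hi1 hi2
      by_contra hne
      have := (hv i hne).1
      rw [sqrt_of hi1 hi2, he, cyl_pre] at this
      exact hvz this
    have hsub : ((EE ∩ B) \ C z k) ∩ C u (n*n) ⊆ C u (n * n + (2 * n + 1)) := by
      rintro v ⟨⟨⟨hvE, hvB⟩, hvz⟩, hvu⟩ i hi
      by_cases hin : i < n * n
      · exact hvu i hin
      · rw [hzero v hvE hvz i (by omega) hi, hzero u huE huz i (by omega) hi]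
    refine (measure_mono hsub).trans ?_
    have h3 := meas_cnt hρ u (show n * n ≤ n * n + (2 * n + 1) by omega)
    have h4 := balanced_cnt hB (y := z) huB (n * n + (2 * n + 1))
    have h5 := balanced_cnt hB (y := u) hzB (n * n)
    obtain ⟨c, hcc⟩ : ∃ c, cnt B u (n * n + (2 * n + 1)) = c + cnt B u (n * n) :=
      ⟨cnt B u (n * n + (2 * n + 1)) - cnt B u (n * n), by omega⟩
    rw [hcc, pow_add, ← mul_assoc, ENNReal.mul_le_mul_iff_left (by simp) (by simp)] at h3
    exact le_inv _ _ c (by omega) h3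
  have h3 : ρ ((EE ∩ B) \ C z k) ≤ 2⁻¹ ^ M := by
    have := descent ρ ((EE ∩ B) \ C z k) (2⁻¹ ^ M) 0 (n*n) (by simpa using h2) 0
    have hu : C (0 : CS) 0 = univ := by ext; simp [C]
    rwa [hu, inter_univ, measure_univ, mul_one] at this
  calc ρ (EE ∩ B) ≤ ρ (C z k ∪ ((EE ∩ B) \ C z k)) := measure_mono (by
        intro v hv
        by_cases hvz : v ∈ C z k
        · exact Or.inl hvz
        · exact Or.inr ⟨hv, hvz⟩)
    _ ≤ ρ (C z k) + ρ ((EE ∩ B) \ C z k) := measure_union_le _ _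
    _ ≤ 2⁻¹ ^ M + 2⁻¹ ^ M := add_le_add h1 h3
    _ = 2 * 2⁻¹ ^ M := by ring

/-- There exists a perfect set `E` such that for every balanced perfect `B`,
either `E` is `B`-null or `B` is `E`-null. -/
theorem stmt_6 : ∃ E : Set CS, PerfSet E ∧
    ∀ B : Set CS, BalancedPerf B → PNull B E ∨ PNull E B := by
  refine ⟨EE, EE_perf, fun B hB => ?_⟩
  by_cases hn : PNull EE B
  · exact Or.inr hn
  left
  unfold PNull at hn
  push Not at hn
  obtain ⟨ν, hν, hpos⟩ := hn
  intro ρ hρ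
  by_contra hne
  obtain ⟨m, hm⟩ := ENNReal.exists_inv_two_pow_lt hne
  have := final hB hν hρ hpos (m+1)
  rw [pow_succ, mul_comm, mul_assoc, ENNReal.inv_mul_cancel (by simp) (by simp), mul_one] at this
  exact absurd hm (not_lt.2 this)
end

section
/- If there exists a Sierpiński set, then PN ⊊ bPN: there exists a set X ⊆ 2^ω that is B-null for every balanced perfect set B ⊆ 2^ω but is not perfectly null. -/
open MeasureTheory Set Pointwise

namespace PNaux

/-- cylinder around a point -/
def C (y : CS) (n : ℕ) : Set CS := {x | ∀ i, i < n → x i = y i}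

/-- initial segment of a point -/
def pre (y : CS) (n : ℕ) : List (ZMod 2) := (List.range n).map y

lemma pre_length (y : CS) (n : ℕ) : (pre y n).length = n := by simp [pre]

lemma pre_succ (y : CS) (n : ℕ) : pre y (n+1) = pre y n ++ [y n] := by
  simp [pre, List.range_succ]

lemma cyl_pre (y : CS) (n : ℕ) : cyl (pre y n) = C y n := by
  ext x
  simp only [cyl, C, pre_length, mem_ofPred_eq]
  refine forall_congr' fun i => forall_congr' fun hi => ?_
  simp [pre, hi]

lemma zz (a : ZMod 2) : a = 0 ∨ a = 1 := by revert a; decide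

lemma C_congr {y z : CS} {n : ℕ} (h : ∀ i < n, y i = z i) : C y n = C z n := by
  ext x
  exact forall_congr' fun i => forall_congr' fun hi => by rw [h i hi]

lemma pre_congr {y z : CS} {n : ℕ} (h : ∀ i < n, y i = z i) : pre y n = pre z n := by
  apply List.map_congr_left
  intro i hi
  exact h i (List.mem_range.1 hi)

lemma meas_coord (i : ℕ) (b : ZMod 2) : MeasurableSet {x : CS | x i = b} := by
  have hm : Measurable (fun x : CS => x i) := measurable_pi_apply i
  exact hm (measurableSet_singleton b)

lemma meas_cube (F : Finset ℕ) (y : CS) : MeasurableSet {x : CS | ∀ i ∈ F, x i = y i} := by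
  have : {x : CS | ∀ i ∈ F, x i = y i} = ⋂ i ∈ F, {x : CS | x i = y i} := by
    ext x; simp
  rw [this]
  exact Finset.measurableSet_biInter _ fun i _ => meas_coord i _

lemma meas_C (y : CS) (n : ℕ) : MeasurableSet (C y n) := by
  have := meas_cube (Finset.range n) y
  simpa [C] using this

lemma half_add (n : ℕ) : (2:ENNReal)⁻¹ ^ (n+1) + (2:ENNReal)⁻¹ ^ (n+1) = (2:ENNReal)⁻¹ ^ n := by
  rw [pow_succ, ← mul_add, ENNReal.inv_two_add_inv_two, mul_one]

lemma cube_aux (μ : Measure CS) (hμ : IsFairCoin μ) (n m : ℕ) :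
    ∀ (F : Finset ℕ) (y : CS), F ⊆ Finset.range n → F.card + m = n →
      μ {x | ∀ i ∈ F, x i = y i} = (2 : ENNReal)⁻¹ ^ F.card := by
  induction m with
  | zero =>
    intro F y hF hc
    have : F = Finset.range n := Finset.eq_of_subset_of_card_le hF (by simp; omega)
    subst this
    have h := hμ.2 (pre y n)
    rw [cyl_pre, pre_length] at h
    simpa [C] using h
  | succ m ih =>
    intro F y hF hc
    obtain ⟨j, hj, hjF⟩ : ∃ j ∈ Finset.range n, j ∉ F := by
      by_contra hcon
      push Not at hcon
      have := Finset.card_le_card (show Finset.range n ⊆ F from hcon)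
      simp at this
      omega
    have hins : insert j F ⊆ Finset.range n := Finset.insert_subset hj hF
    have hcard : (insert j F).card = F.card + 1 := Finset.card_insert_of_notMem hjF
    have key : ∀ b, μ ({x | ∀ i ∈ F, x i = y i} ∩ {x | x j = b}) = (2 : ENNReal)⁻¹ ^ (F.card+1) := by
      intro b
      have := ih (insert j F) (Function.update y j b) hins (by omega)
      rw [hcard] at this
      rw [← this]
      congr 1
      ext x
      simp only [mem_inter_iff, mem_ofPred_eq, Finset.mem_insert, forall_eq_or_imp,
        Function.update_self]
      rw [and_comm]
      refine and_congr Iff.rfl (forall_congr' fun i => forall_congr' fun hi => ?_)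
      rw [Function.update_of_ne]
      rintro rfl; exact hjF hi
    rw [← half_add, ← measure_inter_add_sdiff _ (meas_coord j 0), key 0]
    congr 1
    rw [← key 1]
    congr 1
    ext x
    simp only [mem_sdiff, mem_inter_iff, mem_ofPred_eq]
    refine and_congr Iff.rfl ?_
    generalize x j = a
    revert a; decide

lemma cube (μ : Measure CS) (hμ : IsFairCoin μ) (F : Finset ℕ) (y : CS) :
    μ {x | ∀ i ∈ F, x i = y i} = (2 : ENNReal)⁻¹ ^ F.card := by
  have hs : F ⊆ Finset.range (F.sup id + 1) := by
    intro i hi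
    have : i ≤ F.sup id := Finset.le_sup (f := id) hi
    simp; omega
  have := Finset.card_le_card hs
  exact cube_aux μ hμ _ (F.sup id + 1 - F.card) F y hs (by simp at this; omega)

/-! ### the block structure -/

def s : ℕ → ℕ
  | 0 => 0
  | k+1 => s k + (2^k + 1)

lemma s_mono : StrictMono s := strictMono_nat_of_lt_succ fun k => by
  have h1 : s (k+1) = s k + (2^k+1) := rfl
  have h2 : 0 < 2^k := by positivity
  rw [h1]
  exact Nat.lt_add_of_pos_right (Nat.succ_pos _)

open Classical in
noncomputable def st : ℕ → ℕ
  | 0 => 0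
  | n+1 => if (∃ k, s k = n+1) then n+1 else st n

lemma st_le : ∀ n, st n ≤ n
  | 0 => le_rfl
  | n+1 => by
    rw [st]
    split_ifs
    · exact le_rfl
    · exact (st_le n).trans (Nat.le_succ n)

lemma st_s (k : ℕ) : st (s k) = s k := by
  rcases h : s k with _ | n
  · rfl
  · rw [st, if_pos ⟨k, h⟩]

lemma st_mem : ∀ n, ∃ k, s k = st n
  | 0 => ⟨0, rfl⟩
  | n+1 => by
    rw [st]
    split_ifs with h
    · exact h
    · exact st_mem n

lemma st_st (n : ℕ) : st (st n) = st n := by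
  obtain ⟨k, hk⟩ := st_mem n
  rw [← hk, st_s]

lemma st_block (k j : ℕ) (hj : j < 2^k+1) : st (s k + j) = s k := by
  induction j with
  | zero => exact st_s k
  | succ j ih =>
    rw [← add_assoc, st, if_neg, ih (by omega)]
    rintro ⟨l, hl⟩
    have h1 : s k < s l := by omega
    have h2 : s l < s (k+1) := by
      have : s (k+1) = s k + (2^k+1) := rfl
      omega
    rw [s_mono.lt_iff_lt] at h1 h2
    omega

/-- the retraction -/
noncomputable def h (x : CS) : CS := fun n => x n * x (st n)

def P : Set CS := {x | h x = x}

lemma mul_self_z (a : ZMod 2) : a * a = a := by revert a; decide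

lemma h_fix (x : CS) {n : ℕ} (hn : st n = n) : h x n = x n := by
  simp [h, hn, mul_self_z]

lemma h_mem (x : CS) : h x ∈ P := by
  funext n
  show h x n * h x (st n) = h x n
  rw [h_fix x (st_st n)]
  simp only [h]
  rw [mul_assoc, mul_self_z]

lemma h_cont : Continuous h := by
  unfold h
  fun_prop

lemma h_meas : Measurable h := by
  refine measurable_pi_lambda _ fun n => ?_
  have : Measurable fun p : ZMod 2 × ZMod 2 => p.1 * p.2 := measurable_of_countable _
  have h1 : Measurable (fun x : CS => x n) := measurable_pi_apply n
  have h2 : Measurable (fun x : CS => x (st n)) := measurable_pi_apply (st n)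
  exact this.comp (h1.prodMk h2)

lemma P_closed : IsClosed P := isClosed_eq h_cont continuous_id

lemma exists_C_subset {y : CS} {U : Set CS} (hU : U ∈ nhds y) : ∃ n, C y n ⊆ U := by
  obtain ⟨V, hV, hVo, hyV⟩ := mem_nhds_iff.1 hU
  obtain ⟨I, u, hu, hsub⟩ := isOpen_pi_iff.1 hVo y hyV
  refine ⟨I.sup id + 1, fun x hx => hV (hsub fun i hi => ?_)⟩
  have : i ≤ I.sup id := Finset.le_sup (f := id) hi
  rw [hx i (by omega)]
  exact (hu i hi).2

lemma C_open (y : CS) (n : ℕ) : IsOpen (C y n) := by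
  have : C y n = (Finset.range n : Set ℕ).pi fun i => {y i} := by
    ext x; simp [C, Set.mem_pi]
  rw [this]
  exact isOpen_set_pi (Finset.finite_toSet _) fun i _ => isOpen_discrete _

lemma C_self (y : CS) (n : ℕ) : y ∈ C y n := fun _ _ => rfl

lemma P_perf : PerfSet P := by
  refine ⟨⟨P_closed, ?_⟩, ⟨h 0, h_mem 0⟩⟩
  intro y hy
  rw [accPt_iff_nhds]
  intro U hU
  obtain ⟨n, hn⟩ := exists_C_subset hU
  set z := Function.update y (s n) (y (s n) + 1) with hz
  have hne : h z (s n) = y (s n) + 1 := by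
    rw [h_fix _ (st_s n), hz, Function.update_self]
  refine ⟨h z, ⟨hn ?_, h_mem z⟩, ?_⟩
  · intro i hi
    have h1 : i < s n := lt_of_lt_of_le hi s_mono.le_apply
    have h2 := st_le i
    have : h z i = h y i := by
      simp only [h, hz]
      rw [Function.update_of_ne (by omega), Function.update_of_ne (by omega)]
    rw [this, hy]
  · intro he
    rw [he] at hne
    generalize y (s n) = a at hne
    revert hne; revert a; decide

noncomputable def F (y : CS) (n : ℕ) : Finset ℕ := {i ∈ Finset.range n | i = st i ∨ y (st i) = 1}

lemma F_congr {y z : CS} {n : ℕ} (hyz : ∀ i < n, y i = z i) : F y n = F z n := by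
  apply Finset.filter_congr
  intro i hi
  rw [hyz (st i) (lt_of_le_of_lt (st_le i) (Finset.mem_range.1 hi))]

lemma fiber {y : CS} (hy : y ∈ P) (n : ℕ) : h ⁻¹' (C y n) = {x | ∀ i ∈ F y n, x i = y i} := by
  ext x
  simp only [mem_preimage, C, mem_ofPred_eq, F, Finset.mem_filter, Finset.mem_range]
  constructor
  · rintro H i ⟨hi, h1 | h1⟩
    · rw [← H i hi, h_fix _ h1.symm]
    · have h2 := H (st i) (lt_of_le_of_lt (st_le i) hi)
      rw [h_fix _ (st_st i), h1] at h2
      have h3 := H i hi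
      simpa [h, h2] using h3
  · intro H i hi
    have h1 := H (st i) ⟨lt_of_le_of_lt (st_le i) hi, Or.inl (st_st i).symm⟩
    have h4 : y i = y i * y (st i) := (congrFun hy i).symm
    show x i * x (st i) = y i
    rw [h1, h4]
    rcases zz (y (st i)) with h2 | h2
    · simp [h2]
    · rw [H i ⟨hi, Or.inr h2⟩]

lemma nu_C (μ : Measure CS) (hμ : IsFairCoin μ) {y : CS} (hy : y ∈ P) (n : ℕ) :
    μ.map h (C y n) = (2:ENNReal)⁻¹ ^ (F y n).card := by
  rw [Measure.map_apply h_meas (meas_C y n), fiber hy, cube μ hμ]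

lemma C_eq_of_mem {y z : CS} {n : ℕ} (hz : z ∈ C y n) : C z n = C y n := C_congr hz

lemma cyl_eq (w : List (ZMod 2)) (b : ZMod 2) :
    ∃ z : CS, z w.length = b ∧ pre z w.length = w ∧ cyl (w ++ [b]) = C z (w.length+1) := by
  refine ⟨fun i => (w ++ [b]).getD i 0, by simp, ?_, ?_⟩
  · apply List.ext_getElem
    · simp [pre]
    · intro i h1 h2
      simp [pre, List.getElem?_append, h2]
  · ext x
    simp [cyl, C]

lemma canon (μ : Measure CS) (hμ : IsFairCoin μ) : IsCanonical P (μ.map h) := by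
  have := hμ.1
  refine ⟨Measure.isProbabilityMeasure_map h_meas.aemeasurable, ?_, ?_⟩
  · rw [Measure.map_apply h_meas P_closed.measurableSet]
    have : h ⁻¹' P = univ := eq_univ_of_forall h_mem
    rw [this]; exact measure_univ
  · rintro w ⟨⟨y, hy, hyP⟩, ⟨z, hz, hzP⟩⟩
    have e0 : cyl (w ++ [0]) = C y (w.length + 1) := by
      obtain ⟨u, -, -, hu⟩ := cyl_eq w 0
      rw [hu] at hy ⊢
      exact (C_congr hy).symm
    have e1 : cyl (w ++ [1]) = C z (w.length + 1) := by
      obtain ⟨u, -, -, hu⟩ := cyl_eq w 1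
      rw [hu] at hz ⊢
      exact (C_congr hz).symm
    have hag : ∀ i < w.length, y i = z i := by
      intro i hi
      rw [hy i (by simp; omega), hz i (by simp; omega)]
      simp [List.getElem?_append, hi]
    have hz1 : z w.length = 1 := by
      rw [hz w.length (by simp)]; simp
    rw [e0, e1, nu_C μ hμ hyP, nu_C μ hμ hzP]
    congr 2
    apply Finset.filter_congr
    intro i hi
    have hi' : i < w.length + 1 := Finset.mem_range.1 hi
    rcases (st_le i).lt_or_eq with hlt | heq
    · rw [hag (st i) (by omega)]
    · simp [heq]

lemma card_F (y : CS) (k : ℕ) :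
    (F y (s k)).card = k + ∑ i ∈ {i ∈ Finset.range k | y (s i) = 1}, 2^i := by
  rw [Finset.sum_filter]
  induction k with
  | zero => simp [s, F]
  | succ k ih =>
    have e : s (k+1) = s k + (2^k+1) := rfl
    unfold F at ih ⊢
    rw [Finset.card_filter] at ih ⊢
    rw [e, Finset.sum_range_add, ih, Finset.sum_range_succ _ k]
    have : ∑ x ∈ Finset.range (2^k+1), (if s k + x = st (s k + x) ∨ y (st (s k + x)) = 1 then 1 else 0)
        = ∑ x ∈ Finset.range (2^k+1), (if x = 0 ∨ y (s k) = 1 then 1 else 0) := by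
      refine Finset.sum_congr rfl fun x hx => ?_
      rw [st_block k x (Finset.mem_range.1 hx)]
      simp
    rw [this, Finset.sum_range_succ']
    by_cases hy : y (s k) = 1 <;> simp [hy] <;> ring

lemma window_one (μ : Measure CS) (hμ : IsFairCoin μ) (k t : ℕ) :
    μ.map h {y | y ∈ P ∧ (F y (s k)).card = t} ≤ (2:ENNReal)⁻¹ ^ k := by
  rcases Set.eq_empty_or_nonempty {y | y ∈ P ∧ (F y (s k)).card = t} with he | ⟨y, hy, hyt⟩
  · rw [he]; simp
  have hsub : {y | y ∈ P ∧ (F y (s k)).card = t} ⊆ {x | ∀ i ∈ (Finset.range k).image s, x i = y i} := by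
    rintro z ⟨hz, hzt⟩
    rw [card_F] at hyt hzt
    have h1 : ∑ i ∈ {i ∈ Finset.range k | z (s i) = 1}, 2^i
      = ∑ i ∈ {i ∈ Finset.range k | y (s i) = 1}, 2^i := by omega
    have h2 := Finset.geomSum_injective (le_refl 2) h1
    intro i hi
    obtain ⟨j, hj, rfl⟩ := Finset.mem_image.1 hi
    have h3 := Finset.ext_iff.1 h2 j
    simp only [Finset.mem_filter, hj, true_and] at h3
    generalize y (s j) = a at *
    generalize z (s j) = b at *
    revert h3; revert a b; decide
  refine (measure_mono hsub).trans ?_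
  rw [Measure.map_apply h_meas (meas_cube _ _)]
  have : h ⁻¹' {x | ∀ i ∈ (Finset.range k).image s, x i = y i} =
      {x | ∀ i ∈ (Finset.range k).image s, x i = y i} := by
    ext x
    refine forall_congr' fun i => forall_congr' fun hi => ?_
    obtain ⟨j, hj, rfl⟩ := Finset.mem_image.1 hi
    rw [h_fix x (st_s j)]
  rw [this, cube μ hμ, Finset.card_image_of_injective _ s_mono.injective, Finset.card_range]

lemma window (μ : Measure CS) (hμ : IsFairCoin μ) (k d M : ℕ) :
    μ.map h {y | y ∈ P ∧ d < (F y (s k)).card + M ∧ (F y (s k)).card < d + M}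
      ≤ (2*M : ℕ) * (2:ENNReal)⁻¹ ^ k := by
  have hsub : {y | y ∈ P ∧ d < (F y (s k)).card + M ∧ (F y (s k)).card < d + M} ⊆
      ⋃ t ∈ Finset.Ico (d - M) (d + M), {y | y ∈ P ∧ (F y (s k)).card = t} := by
    rintro y ⟨hy, h1, h2⟩
    simp only [mem_iUnion]
    exact ⟨(F y (s k)).card, by simp; omega, hy, rfl⟩
  refine (measure_mono hsub).trans ((measure_biUnion_finset_le _ _).trans ?_)
  refine (Finset.sum_le_card_nsmul _ _ _ fun t _ => window_one μ hμ k t).trans ?_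
  rw [nsmul_eq_mul]
  gcongr
  simp; omega

/-- comparing measures through cylinders -/
lemma compare (α β : Measure CS) (L : ℕ) (κ : ENNReal) (A : Set CS)
    (hA : ∀ y ∈ A, α (C y L) ≤ κ * β (C y L)) : α A ≤ κ * β univ := by
  classical
  let g : CS → (Fin L → ZMod 2) := fun x i => x i
  have hg : ∀ y, g ⁻¹' {g y} = C y L := by
    intro y
    ext x
    simp only [mem_preimage, mem_singleton_iff, C, mem_ofPred_eq, funext_iff, g]
    exact ⟨fun H i hi => H ⟨i, hi⟩, fun H i => H i i.2⟩
  let T : Finset (Fin L → ZMod 2) := (Set.toFinite (g '' A)).toFinset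
  have hT : ∀ t ∈ T, ∃ y ∈ A, g y = t := by
    intro t ht
    have := (Set.Finite.mem_toFinset (Set.toFinite (g '' A))).1 ht
    exact this
  calc α A ≤ α (⋃ t ∈ T, g ⁻¹' {t}) := by
        refine measure_mono fun y hy => ?_
        simp only [mem_iUnion]
        exact ⟨g y, (Set.Finite.mem_toFinset _).2 ⟨y, hy, rfl⟩, rfl⟩
    _ ≤ ∑ t ∈ T, α (g ⁻¹' {t}) := measure_biUnion_finset_le _ _
    _ ≤ ∑ t ∈ T, κ * β (g ⁻¹' {t}) := by
        refine Finset.sum_le_sum fun t ht => ?_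
        obtain ⟨y, hy, rfl⟩ := hT t ht
        rw [hg]; exact hA y hy
    _ = κ * β (⋃ t ∈ T, g ⁻¹' {t}) := by
        rw [← Finset.mul_sum, measure_biUnion_finset]
        · intro a _ b _ hab
          exact Disjoint.preimage _ (by simpa using hab)
        · intro t ht
          obtain ⟨y, hy, rfl⟩ := hT t ht
          rw [hg]; exact meas_C y L
    _ ≤ κ * β univ := by gcongr; exact subset_univ _

/-! ### balanced sets -/

open Classical in
noncomputable def b (B : Set CS) (y : CS) (n : ℕ) : ℕ :=
  ((Finset.range n).filter fun i => Branch B (pre y i)).card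

lemma initSeg_pre {y : CS} {n : ℕ} {u : List (ZMod 2)} :
    u <+: pre y n ↔ ∃ m ≤ n, u = pre y m := by
  constructor
  · intro hu
    have hl := hu.length_le
    rw [pre_length] at hl
    refine ⟨u.length, hl, ?_⟩
    rw [List.prefix_iff_eq_take.1 hu]
    simp [pre, ← List.map_take, List.take_range]
  · rintro ⟨m, hm, rfl⟩
    refine List.IsPrefix.map _ ?_
    rw [List.prefix_iff_eq_take]
    simp [List.take_range, hm]

lemma brCount_pre (B : Set CS) (y : CS) (n : ℕ) : brCount B (pre y n) = b B y n := by
  classical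
  unfold brCount b
  have : {u : List (ZMod 2) | u <+: pre y n ∧ u ≠ pre y n ∧ Branch B u} =
      (((Finset.range n).filter fun i => Branch B (pre y i)).image (pre y) : Finset _) := by
    ext u
    simp only [mem_ofPred_eq, Finset.coe_image, mem_image, Finset.mem_coe, Finset.mem_filter,
      Finset.mem_range, initSeg_pre]
    constructor
    · rintro ⟨⟨m, hm, rfl⟩, h1, h2⟩
      refine ⟨m, ⟨lt_of_le_of_ne hm ?_, h2⟩, rfl⟩
      rintro rfl; exact h1 rfl
    · rintro ⟨m, ⟨hm, h2⟩, rfl⟩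
      refine ⟨⟨m, hm.le, rfl⟩, ?_, h2⟩
      intro he
      have := congrArg List.length he
      rw [pre_length, pre_length] at this
      omega
  rw [this, Set.ncard_coe_finset, Finset.card_image_of_injective]
  intro i j hij
  have := congrArg List.length hij
  rwa [pre_length, pre_length] at this

lemma b_succ (B : Set CS) (y : CS) (n : ℕ) [Decidable (Branch B (pre y n))] :
    b B y (n+1) = b B y n + if Branch B (pre y n) then 1 else 0 := by
  unfold b
  rw [Finset.range_add_one, Finset.filter_insert]
  split_ifs with h1
  · rw [Finset.card_insert_of_notMem (by simp)]
  · rfl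

lemma b_mono (B : Set CS) (y : CS) : Monotone (b B y) := by
  classical
  exact monotone_nat_of_le_succ fun n => by rw [b_succ]; omega

lemma C_split (y : CS) (n : ℕ) :
    C y n = cyl (pre y n ++ [0]) ∪ cyl (pre y n ++ [1]) ∧
      Disjoint (cyl (pre y n ++ [0])) (cyl (pre y n ++ [1])) ∧
      (∀ c, MeasurableSet (cyl (pre y n ++ [c]))) := by
  have key : ∀ c, cyl (pre y n ++ [c]) = C y n ∩ {x | x n = c} := by
    intro c
    have : pre y n ++ [c] = pre (Function.update y n c) (n+1) := by
      rw [pre_succ, Function.update_self]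
      congr 1
      exact pre_congr fun i hi => by rw [Function.update_of_ne hi.ne]
    rw [this, cyl_pre]
    ext x
    simp only [C, mem_ofPred_eq, mem_inter_iff]
    constructor
    · intro H
      refine ⟨fun i hi => ?_, ?_⟩
      · rw [H i (by omega), Function.update_of_ne hi.ne]
      · rw [H n (by omega), Function.update_self]
    · rintro ⟨H1, H2⟩ i hi
      rcases eq_or_ne i n with rfl | hne
      · rw [H2, Function.update_self]
      · rw [H1 i (by omega), Function.update_of_ne hne]
  refine ⟨?_, ?_, fun c => ?_⟩
  · rw [key, key, ← inter_union_distrib_left]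
    refine (inter_eq_left.2 fun x _ => zz (x n)).symm
  · rw [key, key]
    rw [Set.disjoint_left]
    rintro x ⟨_, h1⟩ ⟨_, h2⟩
    simp only [mem_ofPred_eq] at h1 h2
    rw [h1] at h2; revert h2; decide
  · rw [key]; exact (meas_C y n).inter (meas_coord n c)

lemma beta_C {B : Set CS} (hB : IsClosed B) {β : Measure CS} (hβ : IsCanonical B β) {y : CS}
    (hy : y ∈ B) (n : ℕ) : β (C y n) = (2:ENNReal)⁻¹ ^ (b B y n) := by
  classical
  have hp := hβ.1
  have hBc : β Bᶜ = 0 := (prob_compl_eq_zero_iff hB.measurableSet).2 hβ.2.1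
  induction n with
  | zero =>
    have : C y 0 = univ := by ext; simp [C]
    rw [this]; simp [b]
  | succ n ih =>
    obtain ⟨h1, h2, h3⟩ := C_split y n
    have hC : C y (n+1) = cyl (pre y n ++ [y n]) := by rw [← pre_succ, cyl_pre]
    have hsum : β (C y n) = β (cyl (pre y n ++ [0])) + β (cyl (pre y n ++ [1])) := by
      rw [h1, measure_union h2 (h3 1)]
    rw [ih] at hsum
    rw [b_succ, hC]
    have hmem : y ∈ cyl (pre y n ++ [y n]) := by rw [← hC]; exact C_self _ _
    split_ifs with hbr
    · have he := hβ.2.2 _ hbr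
      rw [← he, ← mul_two] at hsum
      have h0 : β (cyl (pre y n ++ [0])) = (2:ENNReal)⁻¹ ^ (b B y n + 1) := by
        rw [pow_succ, hsum, mul_assoc, ENNReal.mul_inv_cancel (by simp) (by simp), mul_one]
      rcases zz (y n) with hh | hh
      · rw [hh, h0]
      · rw [hh, ← he, h0]
    · have hz : ∀ c, ¬ (cyl (pre y n ++ [c]) ∩ B).Nonempty → β (cyl (pre y n ++ [c])) = 0 := by
        intro c hc
        refine measure_mono_null (fun x hx hxB => hc ⟨x, hx, hxB⟩) hBc
      rw [add_zero]
      rcases zz (y n) with hh | hh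
      · rw [hh] at hmem ⊢
        rw [hz 1 fun hc => hbr ⟨⟨y, hmem, hy⟩, hc⟩, add_zero] at hsum
        exact hsum.symm
      · rw [hh] at hmem ⊢
        rw [hz 0 fun hc => hbr ⟨hc, ⟨y, hmem, hy⟩⟩, zero_add] at hsum
        exact hsum.symm

lemma exists_branch {B : Set CS} (hB : PerfSet B) {y : CS} (hy : y ∈ B) (L : ℕ) :
    ∃ n ≥ L, Branch B (pre y n) := by
  classical
  have hacc := hB.1.acc _ hy
  rw [accPt_iff_nhds] at hacc
  obtain ⟨z, ⟨hzC, hzB⟩, hne⟩ := hacc (C y L) ((C_open y L).mem_nhds (C_self y L))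
  have hex : ∃ n, z n ≠ y n := by
    by_contra hcon
    push Not at hcon
    exact hne (funext hcon)
  let n := Nat.find hex
  have hn : z n ≠ y n := Nat.find_spec hex
  have hlt : ∀ i < n, z i = y i := fun i hi => not_not.1 (Nat.find_min hex hi)
  refine ⟨n, ?_, ?_⟩
  · by_contra hcon
    exact hn (hzC n (by omega))
  have e1 : y ∈ cyl (pre y n ++ [y n]) := by rw [← pre_succ, cyl_pre]; exact C_self _ _
  have e2 : z ∈ cyl (pre y n ++ [z n]) := by
    rw [← pre_congr hlt, ← pre_succ, cyl_pre]; exact C_self _ _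
  rcases zz (y n) with hh | hh <;> rcases zz (z n) with hk | hk
  · exact absurd (hk.trans hh.symm) hn
  · rw [hh] at e1; rw [hk] at e2; exact ⟨⟨y, e1, hy⟩, ⟨z, e2, hzB⟩⟩
  · rw [hh] at e1; rw [hk] at e2; exact ⟨⟨z, e2, hzB⟩, ⟨y, e1, hy⟩⟩
  · exact absurd (hk.trans hh.symm) hn

lemma b_unbdd {B : Set CS} (hB : PerfSet B) {y : CS} (hy : y ∈ B) (m : ℕ) :
    ∃ n, m ≤ b B y n := by
  classical
  induction m with
  | zero => exact ⟨0, Nat.zero_le _⟩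
  | succ m ih =>
    obtain ⟨n, hn⟩ := ih
    obtain ⟨l, hl, hbr⟩ := exists_branch hB hy n
    refine ⟨l+1, ?_⟩
    rw [b_succ, if_pos hbr]
    have := b_mono B y hl
    omega

lemma atomless {B : Set CS} (hB : PerfSet B) {β : Measure CS} (hβ : IsCanonical B β) (y : CS) :
    β {y} = 0 := by
  have hp := hβ.1
  by_cases hy : y ∈ B
  · have hlim := ENNReal.tendsto_pow_atTop_nhds_zero_of_lt_one (r := 2⁻¹) (by simp)
    refine le_antisymm (ge_of_tendsto' hlim fun m => ?_) bot_le
    obtain ⟨n, hn⟩ := b_unbdd hB hy m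
    calc β {y} ≤ β (C y n) := measure_mono (by simpa using C_self y n)
      _ = 2⁻¹ ^ (b B y n) := beta_C hB.1.closed hβ hy n
      _ ≤ 2⁻¹ ^ m := pow_le_pow_of_le_one bot_le (by simp) hn
  · have hBc : β Bᶜ = 0 := (prob_compl_eq_zero_iff hB.1.closed.measurableSet).2 hβ.2.1
    exact measure_mono_null (by simpa using hy) hBc

/-- the last branching node before `L` -/
lemma exists_last (B : Set CS) (y : CS) (L : ℕ) (hL : b B y L ≠ 0) :
    ∃ n < L, Branch B (pre y n) ∧ b B y n + 1 = b B y L := by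
  classical
  induction L with
  | zero => exact absurd (by simp [b]) hL
  | succ L ih =>
    by_cases hbr : Branch B (pre y L)
    · exact ⟨L, by omega, hbr, by rw [b_succ, if_pos hbr]⟩
    · have e : b B y (L+1) = b B y L := by rw [b_succ, if_neg hbr, add_zero]
      rw [e] at hL ⊢
      obtain ⟨n, h1, h2, h3⟩ := ih hL
      exact ⟨n, by omega, h2, h3⟩

lemma exists_first {B : Set CS} (hB : PerfSet B) {y : CS} (hy : y ∈ B) (L : ℕ) :
    ∃ n ≥ L, Branch B (pre y n) ∧ b B y n = b B y L := by
  classical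
  have hex := exists_branch hB hy L
  let n := Nat.find hex
  obtain ⟨h1, h2⟩ := Nat.find_spec hex
  refine ⟨n, h1, h2, ?_⟩
  have : ∀ m, L ≤ m → m ≤ n → b B y m = b B y L := by
    intro m hm
    induction m, hm using Nat.le_induction with
    | base => intro _; rfl
    | succ m hm ih =>
      intro hmn
      rw [b_succ, if_neg, ih (by omega), add_zero]
      intro hbr
      exact Nat.find_min hex (show m < n by omega) ⟨hm, hbr⟩
  exact this n h1 le_rfl

lemma balanced_b {B : Set CS} (hB : BalancedPerf B) {y z : CS} (hy : y ∈ B) (hz : z ∈ B) (L : ℕ) :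
    b B y L ≤ b B z L + 1 := by
  by_contra hcon
  obtain ⟨n, hn, hbn, hcn⟩ := exists_last B y L (by omega)
  obtain ⟨m, hm, hbm, hcm⟩ := exists_first hB.1 hz L
  have := hB.2 _ _ hbm hbn (by rw [brCount_pre, brCount_pre]; omega)
  rw [pre_length, pre_length] at this
  omega

lemma exists_d {B : Set CS} (hB : BalancedPerf B) (L : ℕ) :
    ∃ d, ∀ y ∈ B, d ≤ b B y L ∧ b B y L ≤ d + 1 := by
  classical
  have hex : ∃ d, ∃ y ∈ B, b B y L = d := by
    obtain ⟨y, hy⟩ := hB.1.2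
    exact ⟨_, y, hy, rfl⟩
  obtain ⟨z, hz, hzd⟩ := Nat.find_spec hex
  refine ⟨Nat.find hex, fun y hy => ⟨Nat.find_min' hex ⟨y, hy, rfl⟩, ?_⟩⟩
  rw [← hzd]
  exact balanced_b hB hy hz L

lemma two_mul_le (M : ℕ) : 2 * M ≤ 2 ^ M := by
  induction M with
  | zero => simp
  | succ M ih =>
    rcases Nat.eq_zero_or_pos M with rfl | hM
    · simp
    · rw [pow_succ]
      omega

lemma split (μ : Measure CS) (hμ : IsFairCoin μ) {B : Set CS} (hB : BalancedPerf B) {β : Measure CS}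
    (hβ : IsCanonical B β) (j : ℕ) :
    ∃ E : Set CS, μ.map h E ≤ (2:ENNReal)⁻¹ ^ j ∧ β ((P ∩ B) \ E) ≤ (2:ENNReal)⁻¹ ^ j := by
  have hp := hβ.1
  have hp' := (canon μ hμ).1
  have hle : (2:ENNReal)⁻¹ ≤ 1 := by simp
  obtain ⟨M, hM⟩ : ∃ M, M = j + 2 := ⟨_, rfl⟩
  obtain ⟨k, hk⟩ : ∃ k, k = M + M := ⟨_, rfl⟩
  obtain ⟨d, hd⟩ := exists_d hB (s k)
  set D : Set CS := {y | y ∈ P ∩ B ∧ d + M ≤ (F y (s k)).card} with hD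
  set W : Set CS := {y | y ∈ P ∧ d < (F y (s k)).card + M ∧ (F y (s k)).card < d + M} with hW
  have h1 : μ.map h D ≤ (2:ENNReal)⁻¹ ^ (j+1) := by
    have := compare (μ.map h) β (s k) ((2:ENNReal)⁻¹ ^ (j+1)) D ?_
    · simpa using this
    · rintro y ⟨⟨hyP, hyB⟩, hy⟩
      rw [nu_C μ hμ hyP, beta_C hB.1.1.closed hβ hyB, ← pow_add]
      refine pow_le_pow_of_le_one bot_le hle ?_
      have := (hd y hyB).2
      omega
  have h2 : μ.map h W ≤ (2:ENNReal)⁻¹ ^ (j+1) := by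
    refine (window μ hμ k d M).trans ?_
    calc ((2*M : ℕ) : ENNReal) * 2⁻¹ ^ k ≤ ((2^M : ℕ) : ENNReal) * 2⁻¹ ^ k := by
          gcongr; exact two_mul_le M
      _ = 2⁻¹ ^ M := by
          rw [hk, pow_add, ← mul_assoc]
          push_cast
          rw [← mul_pow, ENNReal.mul_inv_cancel (by simp) (by simp), one_pow, one_mul]
      _ ≤ _ := pow_le_pow_of_le_one bot_le hle (by omega)
  refine ⟨D ∪ W, ?_, ?_⟩
  · refine (measure_union_le _ _).trans ?_
    rw [← half_add]
    exact add_le_add h1 h2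
  · have := compare β (μ.map h) (s k) ((2:ENNReal)⁻¹ ^ j) ((P ∩ B) \ (D ∪ W)) ?_
    · simpa using this
    · rintro y ⟨⟨hyP, hyB⟩, hy⟩
      rw [nu_C μ hμ hyP, beta_C hB.1.1.closed hβ hyB, ← pow_add]
      refine pow_le_pow_of_le_one bot_le hle ?_
      have := (hd y hyB).1
      have n1 : ¬ (d + M ≤ (F y (s k)).card) := fun hc => hy (Or.inl ⟨⟨hyP, hyB⟩, hc⟩)
      have n2 : ¬ (d < (F y (s k)).card + M) := fun hc => hy (Or.inr ⟨hyP, hc, by omega⟩)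
      omega

lemma singular (μ : Measure CS) (hμ : IsFairCoin μ) {B : Set CS} (hB : BalancedPerf B)
    {β : Measure CS} (hβ : IsCanonical B β) :
    ∃ N : Set CS, μ.map h N = 0 ∧ β ((P ∩ B) \ N) = 0 := by
  choose E hE1 hE2 using split μ hμ hB hβ
  have hs : ∑' j : ℕ, (2:ENNReal)⁻¹ ^ j ≠ ⊤ := by
    rw [ENNReal.tsum_geometric, ENNReal.one_sub_inv_two, inv_inv]; simp
  refine ⟨Filter.limsup E Filter.atTop, ?_, ?_⟩
  · exact measure_limsup_atTop_eq_zero (ne_top_of_le_ne_top hs (ENNReal.tsum_le_tsum hE1))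
  · refine measure_mono_null ?_
      (measure_limsup_atTop_eq_zero (s := fun j => (P ∩ B) \ E j)
        (ne_top_of_le_ne_top hs (ENNReal.tsum_le_tsum hE2)))
    rintro x ⟨hx, hxN⟩
    rw [Filter.mem_limsup_iff_frequently_mem] at hxN ⊢
    rw [Filter.not_frequently] at hxN
    exact (hxN.mono fun j hj => ⟨hx, hj⟩).frequently

end PNaux

open PNaux in
/-- If there exists a Sierpiński set, then `PN ⊊ bPN`: some `X` is `B`-null
for every balanced perfect `B` but is not perfectly null. -/
theorem stmt_7 (μ : Measure CS) (hμ : IsFairCoin μ) (S : Set CS) (hS : Sierpinski μ S) :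
    ∃ X : Set CS, (∀ B, BalancedPerf B → PNull B X) ∧ ¬ PerfectlyNull X := by
  refine ⟨PNaux.h '' S, ?_, ?_⟩
  · intro B hB β hβ
    obtain ⟨N, hN1, hN2⟩ := singular μ hμ hB hβ
    have hc : (S ∩ PNaux.h ⁻¹' N).Countable := by
      refine hS.2 _ (le_antisymm ?_ bot_le)
      rw [← hN1]
      exact Measure.le_map_apply h_meas.aemeasurable N
    have hc' : β (PNaux.h '' (S ∩ PNaux.h ⁻¹' N)) = 0 := by
      rw [← biUnion_of_singleton (PNaux.h '' (S ∩ PNaux.h ⁻¹' N))]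
      exact (measure_biUnion_null_iff (hc.image _)).2 fun y _ => atomless hB.1 hβ y
    refine measure_mono_null ?_ (measure_union_null hc' hN2)
    rintro _ ⟨⟨x, hx, rfl⟩, hxB⟩
    by_cases hxN : PNaux.h x ∈ N
    · exact Or.inl ⟨x, ⟨hx, hxN⟩, rfl⟩
    · exact Or.inr ⟨⟨h_mem x, hxB⟩, hxN⟩
  · intro hX
    have h0 := hX P P_perf _ (canon μ hμ)
    have hS0 : μ S = 0 := by
      refine le_antisymm ?_ bot_le
      rw [← h0]
      refine (measure_mono ?_).trans (Measure.le_map_apply h_meas.aemeasurable _)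
      intro x hx
      exact ⟨⟨x, hx, rfl⟩, h_mem x⟩
    exact hS.1 (by simpa using hS.2 S hS0)
end

section
/- Let μ be a finite diffused Borel measure on 2^ω, let G ⊆ 2^ω be a G_δ set, and let Y ⊆ 2^ω be a null-additive set such that for every Borel map φ : Y → ω^ω there exists α ∈ ω^ω with φ(y) ≤* α for every y ∈ Y. If μ(G + y) = 0 for every y ∈ Y, then μ(G + Y) = 0. -/
open MeasureTheory Set Pointwise

theorem fiber_card {A B : Type*} [AddGroup A] [AddGroup B] [Fintype A] [Fintype B] [DecidableEq B]
    (f : A →+ B) (hf : Function.Surjective f) (b : B) :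
    (Finset.univ.filter (fun a => f a = b)).card * Fintype.card B = Fintype.card A := by
  have h1 := Finset.card_eq_sum_card_fiberwise (s := (Finset.univ : Finset A)) (t := (Finset.univ : Finset B))
    (f := f) (by intro a _; simp)
  have h2 : ∀ c ∈ (Finset.univ : Finset B), (Finset.univ.filter (fun a => f a = c)).card
      = (Finset.univ.filter (fun a => f a = b)).card := by
    intro c _
    exact AddMonoidHom.card_fiber_eq_of_mem_range f (hf c) (hf b)
  rw [Finset.sum_congr rfl h2] at h1
  simp at h1
  rw [h1, mul_comm]

theorem z2 (a : ZMod 2) : a ≠ 0 → a = 1 := by revert a; decide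

theorem functional1 {F : ℕ} (x : Fin F → ZMod 2) (hx : x ≠ 0) : ∃ l : Fin F → ZMod 2, l ⬝ᵥ x = 1 := by
  obtain ⟨i, hi⟩ := Function.ne_iff.1 hx
  exact ⟨Pi.single i 1, by simp [z2 _ hi]⟩

theorem functional2 {F : ℕ} (x y : Fin F → ZMod 2) (hx : x ≠ 0) (hxy : x ≠ y) :
    ∃ l : Fin F → ZMod 2, l ⬝ᵥ x = 1 ∧ l ⬝ᵥ y = 0 := by
  obtain ⟨i, hi⟩ := Function.ne_iff.1 hxy
  obtain ⟨j, hj⟩ := Function.ne_iff.1 hx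
  have key : ∀ a b c d : ZMod 2, a ≠ b → c ≠ 0 → (a = 1 ∧ b = 0) ∨ (c = 1 ∧ d = 0) ∨ (a + c = 1 ∧ b + d = 0) := by
    decide
  rcases key _ _ (x j) (y j) hi hj with h | h | h
  · exact ⟨Pi.single i 1, by simp [h]⟩
  · exact ⟨Pi.single j 1, by simp [h]⟩
  · exact ⟨Pi.single i 1 + Pi.single j 1, by simp [add_dotProduct, h]⟩

theorem fiber1 {n F : ℕ} (x : Fin F → ZMod 2) (hx : x ≠ 0) (c : Fin n → ZMod 2) :
    (Finset.univ.filter (fun V : Fin n → Fin F → ZMod 2 => (fun j => V j ⬝ᵥ x) = c)).card * 2 ^ n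
      = Fintype.card (Fin n → Fin F → ZMod 2) := by
  obtain ⟨l, hl⟩ := functional1 x hx
  let f : (Fin n → Fin F → ZMod 2) →+ (Fin n → ZMod 2) :=
    { toFun := fun V j => V j ⬝ᵥ x
      map_zero' := by ext; simp
      map_add' := by intro a b; ext; simp [add_dotProduct] }
  have := fiber_card f (fun d => ⟨fun j => d j • l, by ext j; simp [f, hl]⟩) c
  simpa [f] using this

theorem fiber2 {n F : ℕ} (x y : Fin F → ZMod 2) (hx : x ≠ 0) (hy : y ≠ 0) (hxy : x ≠ y)
    (c d : Fin n → ZMod 2) :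
    (Finset.univ.filter (fun V : Fin n → Fin F → ZMod 2 =>
      (fun j => V j ⬝ᵥ x) = c ∧ (fun j => V j ⬝ᵥ y) = d)).card * (2 ^ n * 2 ^ n)
      = Fintype.card (Fin n → Fin F → ZMod 2) := by
  obtain ⟨l, hl, hl'⟩ := functional2 x y hx hxy
  obtain ⟨k, hk, hk'⟩ := functional2 y x hy hxy.symm
  let f : (Fin n → Fin F → ZMod 2) →+ (Fin n → ZMod 2) × (Fin n → ZMod 2) :=
    { toFun := fun V => (fun j => V j ⬝ᵥ x, fun j => V j ⬝ᵥ y)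
      map_zero' := by ext <;> simp
      map_add' := by intro a b; ext <;> simp [add_dotProduct] }
  have := fiber_card f (fun e => ⟨fun j => e.1 j • l + e.2 j • k, by
    ext j <;> simp [f, hl, hl', hk, hk', add_dotProduct]⟩) (c, d)
  simpa [f] using this

/-- second moment -/
theorem second_moment {n F : ℕ} {ι : Type*} (S : Finset ι) (x : ι → Fin F → ZMod 2)
    (hx : ∀ s ∈ S, x s ≠ 0) (hinj : ∀ s ∈ S, ∀ t ∈ S, s ≠ t → x s ≠ x t)
    (c : ι → Fin n → ZMod 2) (hS : S.card = 4 ^ n) :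
    (Finset.univ.filter (fun V : Fin n → Fin F → ZMod 2 =>
      ∀ s ∈ S, (fun j => V j ⬝ᵥ x s) ≠ c s)).card * 2 ^ n
      ≤ Fintype.card (Fin n → Fin F → ZMod 2) := by
  classical
  set M := (Fintype.card (Fin n → Fin F → ZMod 2) : ℝ) with hM
  set q : ℝ := 2 ^ n with hq
  have hq0 : 0 < q := by positivity
  have hk : (S.card : ℝ) = q * q := by
    rw [hS, hq, ← mul_pow]; norm_num
  let e : ι → (Fin n → Fin F → ZMod 2) → ℝ := fun s V => if (fun j => V j ⬝ᵥ x s) = c s then 1 else 0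
  let N : (Fin n → Fin F → ZMod 2) → ℝ := fun V => ∑ s ∈ S, e s V
  have h1 : ∀ s ∈ S, ∑ V, e s V = M / q := by
    intro s hs
    have := fiber1 (n := n) (x s) (hx s hs) (c s)
    rw [eq_div_iff hq0.ne', hM, ← this]
    simp [e, hq]
  have h2 : ∀ s ∈ S, ∀ t ∈ S, ∑ V, e s V * e t V = M / (q * q) + if s = t then M / q - M / (q * q) else 0 := by
    intro s hs t ht
    split_ifs with hst
    · subst hst
      rw [← h1 s hs]
      rw [add_sub_cancel]
      apply Finset.sum_congr rfl
      intro V _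
      simp [e]
    · have := fiber2 (n := n) (x s) (x t) (hx s hs) (hx t ht) (hinj s hs t ht hst) (c s) (c t)
      rw [add_zero, eq_div_iff (by positivity), hM, ← this]
      push_cast
      congr 1
      simp only [e, ← ite_and, mul_ite, mul_one, mul_zero, Finset.sum_boole]
      congr 2
      ext V
      simp [and_comm]
  have hN1 : ∑ V, N V = q * q * (M / q) := by
    simp only [N]
    rw [Finset.sum_comm, Finset.sum_congr rfl h1, Finset.sum_const, nsmul_eq_mul, hk]
  have hN2 : ∑ V, N V * N V = q * q * (q * q * (M / (q * q)) + (M / q - M / (q * q))) := by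
    simp only [N, Finset.sum_mul_sum]
    rw [Finset.sum_comm]
    have : ∀ s ∈ S, ∑ V, ∑ t ∈ S, e s V * e t V = q * q * (M / (q * q)) + (M / q - M / (q * q)) := by
      intro s hs
      rw [Finset.sum_comm, Finset.sum_congr rfl (h2 s hs), Finset.sum_add_distrib, Finset.sum_const,
        nsmul_eq_mul, hk, Finset.sum_ite_eq, if_pos hs]
    rw [Finset.sum_congr rfl this, Finset.sum_const, nsmul_eq_mul, hk]
  have hvar : ∑ V, (N V - q) ^ 2 ≤ M * q := by
    have : ∑ V, (N V - q) ^ 2 = ∑ V, N V * N V - 2 * q * ∑ V, N V + M * q ^ 2 := by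
      rw [Finset.mul_sum, ← Finset.sum_sub_distrib]
      have : M * q ^ 2 = ∑ V : (Fin n → Fin F → ZMod 2), q ^ 2 := by simp [hM]
      rw [this, ← Finset.sum_add_distrib]
      apply Finset.sum_congr rfl; intros; ring
    rw [this, hN1, hN2]
    have hM0 : 0 ≤ M := by positivity
    field_simp
    nlinarith
  set Bd := Finset.univ.filter (fun V : Fin n → Fin F → ZMod 2 =>
      ∀ s ∈ S, (fun j => V j ⬝ᵥ x s) ≠ c s) with hB
  have hlow : (Bd.card : ℝ) * q ^ 2 ≤ ∑ V, (N V - q) ^ 2 := by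
    calc (Bd.card : ℝ) * q ^ 2 = ∑ V ∈ Bd, (N V - q) ^ 2 := by
          rw [← nsmul_eq_mul, ← Finset.sum_const]
          apply Finset.sum_congr rfl
          intro V hV
          have : N V = 0 := Finset.sum_eq_zero (fun s hs => by
            have := (Finset.mem_filter.1 hV).2 s hs
            simp [e, this])
          rw [this]; ring
      _ ≤ _ := Finset.sum_le_sum_of_subset_of_nonneg (Finset.subset_univ _) (fun _ _ _ => sq_nonneg _)
  have : (Bd.card : ℝ) * q ≤ M := by
    have h := hlow.trans hvar
    have : (Bd.card * q) * q ≤ M * q := by nlinarith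
    exact le_of_mul_le_mul_right this hq0
  rw [hM, hq] at this
  exact_mod_cast this

abbrev TT (n F : ℕ) := (Fin F → ZMod 2) × (Fin n → Fin F → ZMod 2)
def AA (n F : ℕ) : Set (TT n F) := {p | (fun j => p.2 j ⬝ᵥ p.1) = 0}
theorem mem_AA {n F : ℕ} (p : TT n F) : p ∈ AA n F ↔ (fun j => p.2 j ⬝ᵥ p.1) = 0 := Iff.rfl

theorem cardTT (n F : ℕ) : Fintype.card (TT n F) = 2 ^ F * Fintype.card (Fin n → Fin F → ZMod 2) := by
  simp

open Classical in
theorem count_split {n F : ℕ} (R : Finset (TT n F)) (E : Finset (Fin F → ZMod 2)) (hE : E.card * 2 ^ n ≤ 2 ^ F)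
    (h : ∀ u ∉ E, (Finset.univ.filter (fun V => (u, V) ∈ R)).card * 2 ^ n ≤ Fintype.card (Fin n → Fin F → ZMod 2)) :
    R.card * 2 ^ n ≤ 2 * Fintype.card (TT n F) := by
  have h1 : R.card = ∑ u, (Finset.univ.filter (fun V => (u, V) ∈ R)).card := by
    rw [Finset.card_eq_sum_card_fiberwise (s := R) (t := Finset.univ) (f := Prod.fst) (by intro a _; simp)]
    apply Finset.sum_congr rfl
    intro u _
    symm
    apply Finset.card_bij (fun V _ => (u, V))
    · intro V hV; simpa using hV
    · intro V _ W _ h; simpa using h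
    · rintro ⟨u', V⟩ h
      simp at h
      obtain ⟨h, rfl⟩ := h
      exact ⟨V, by simpa using h, rfl⟩
  set M := Fintype.card (Fin n → Fin F → ZMod 2) with hM
  have h2 : ∀ u, (Finset.univ.filter (fun V => (u, V) ∈ R)).card * 2 ^ n ≤ M + (if u ∈ E then M * 2 ^ n else 0) := by
    intro u
    split_ifs with hu
    · have : (Finset.univ.filter (fun V => (u, V) ∈ R)).card ≤ M := Finset.card_le_univ _
      nlinarith [Nat.mul_le_mul_right (2 ^ n) this]
    · simpa using h u hu
  rw [h1, Finset.sum_mul, cardTT, ← hM]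
  refine (Finset.sum_le_sum (fun u _ => h2 u)).trans ?_
  rw [Finset.sum_add_distrib, Finset.sum_ite_mem]
  simp only [Finset.sum_const, Finset.univ_inter, smul_eq_mul]
  have : (Finset.univ : Finset (Fin F → ZMod 2)).card = 2 ^ F := by simp
  rw [this]
  nlinarith [Nat.mul_le_mul_right M hE]

open Classical in
theorem card_AA {n F : ℕ} (hF : 3 * n ≤ F) :
    (Finset.univ.filter (fun p : TT n F => p ∈ AA n F)).card * 2 ^ n ≤ 2 * Fintype.card (TT n F) := by
  apply count_split _ {0}
  · simpa using Nat.pow_le_pow_right (by norm_num) (by omega : n ≤ F)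
  · intro u hu
    have := fiber1 (n := n) u (by simpa using hu) 0
    refine le_of_eq ?_
    rw [← this]
    congr 2
    ext V
    simp [mem_AA]

open Classical in
theorem card_bad {n F : ℕ} (hF : 3 * n ≤ F) {ι : Type*} (S : Finset ι) (p : ι → TT n F)
    (hinj : ∀ s ∈ S, ∀ t ∈ S, s ≠ t → (p s).1 ≠ (p t).1) (hS : S.card = 4 ^ n) :
    (Finset.univ.filter (fun z : TT n F => ∀ s ∈ S, z - p s ∉ AA n F)).card * 2 ^ n
      ≤ 2 * Fintype.card (TT n F) := by
  apply count_split _ (S.image (fun s => (p s).1))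
  · calc _ ≤ 4 ^ n * 2 ^ n := by
          gcongr; exact Finset.card_image_le.trans hS.le
      _ = 2 ^ (3 * n) := by rw [← mul_pow, pow_mul]; norm_num
      _ ≤ _ := Nat.pow_le_pow_right (by norm_num) hF
  · intro u hu
    have := second_moment (n := n) S (fun s => u - (p s).1) (fun s hs h => hu (by
      rw [sub_eq_zero] at h
      exact Finset.mem_image.2 ⟨s, hs, h.symm⟩)) (fun s hs t ht hst h => hinj s hs t ht hst (by simpa using h))
      (fun s j => (p s).2 j ⬝ᵥ (u - (p s).1)) hS
    refine le_trans (le_of_eq ?_) this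
    congr 2
    ext V
    simp only [mem_AA, funext_iff, Finset.mem_filter, Finset.mem_univ, true_and, Prod.fst_sub,
      Prod.snd_sub, Pi.sub_apply, sub_dotProduct, sub_eq_zero, Pi.zero_apply, ne_eq]

theorem meas_fiber (ν : Measure CS) [IsProbabilityMeasure ν] [ν.IsAddLeftInvariant] {T : Type*}
    [AddGroup T] [Fintype T] (f : CS →+ T) (hf : Function.Surjective f)
    (hm : ∀ t, MeasurableSet (f ⁻¹' {t})) (B : Finset T) :
    ν (f ⁻¹' B) * Fintype.card T = B.card := by
  classical
  have h1 : ∀ t, ν (f ⁻¹' {t}) = ν (f ⁻¹' {0}) := by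
    intro t
    obtain ⟨x, hx⟩ := hf t
    rw [← measure_preimage_add ν x (f ⁻¹' {t})]
    congr 1
    ext z
    simp [hx]
  have h2 : ∀ B : Finset T, ν (f ⁻¹' B) = B.card * ν (f ⁻¹' {0}) := by
    intro B
    have : f ⁻¹' (B : Set T) = ⋃ t ∈ B, f ⁻¹' {t} := by ext; simp
    rw [this, measure_biUnion_finset _ (fun t _ => hm t), Finset.sum_congr rfl (fun t _ => h1 t)]
    · simp
    · intro s _ t _ hst
      exact Disjoint.preimage _ (by simpa using hst)
  have h3 := h2 Finset.univ
  simp only [Finset.coe_univ, preimage_univ, measure_univ, Finset.card_univ] at h3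
  rw [h2, mul_assoc, mul_comm (ν _), ← h3, mul_one]

/-- Sets depending on finitely many coordinates. -/
def FinDep (N : ℕ) (C : Set CS) : Prop := ∀ x z : CS, (∀ i < N, x i = z i) → x ∈ C → z ∈ C

theorem FinDep.isOpen {N : ℕ} {C : Set CS} (h : FinDep N C) : IsOpen C := by
  rw [isOpen_iff_forall_mem_open]
  intro x hx
  refine ⟨⋂ i ∈ Finset.range N, {z : CS | z i = x i}, ?_, ?_, ?_⟩
  · intro z hz
    simp at hz
    exact h x z (fun i hi => (hz i hi).symm) hx
  · apply isOpen_biInter_finset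
    intro i _
    have : IsOpen ((fun z : CS => z i) ⁻¹' {x i}) := (isOpen_discrete {x i}).preimage (continuous_apply i)
    exact this
  · simp

theorem FinDep.compl {N : ℕ} {C : Set CS} (h : FinDep N C) : FinDep N Cᶜ :=
  fun x z hxz hx hz => hx (h z x (fun i hi => (hxz i hi).symm) hz)

theorem FinDep.isClosed {N : ℕ} {C : Set CS} (h : FinDep N C) : IsClosed C :=
  isOpen_compl_iff.1 h.compl.isOpen

theorem exists_nhd {O : Set CS} (hO : IsOpen O) {x : CS} (hx : x ∈ O) :
    ∃ N, ∀ z : CS, (∀ i < N, z i = x i) → z ∈ O := by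
  obtain ⟨I, u, h1, h2⟩ := isOpen_pi_iff.1 hO x hx
  refine ⟨I.sup id + 1, fun z hz => h2 ?_⟩
  intro i hi
  have : i ≤ I.sup id := Finset.le_sup (f := id) hi
  rw [hz i (by omega)]
  exact (h1 i hi).2

noncomputable def nu : Measure CS := Measure.addHaarMeasure ⊤

instance : IsProbabilityMeasure nu := ⟨by
  have := Measure.addHaarMeasure_self (G := CS) (K₀ := ⊤)
  simpa [nu] using this⟩

instance : nu.IsAddLeftInvariant := by unfold nu; infer_instance

theorem nu_fair : IsFairCoin nu := by
  refine ⟨inferInstance, fun w => ?_⟩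
  let f : CS →+ (Fin w.length → ZMod 2) :=
    { toFun := fun x i => x i
      map_zero' := rfl
      map_add' := fun _ _ => rfl }
  have hf : Function.Surjective f := by
    intro y
    refine ⟨fun i => if h : i < w.length then y ⟨i, h⟩ else 0, ?_⟩
    ext i
    simp [f]
  have hc : Continuous f := continuous_pi (fun i => continuous_apply _)
  have := meas_fiber nu f hf (fun t => (hc.measurable (measurableSet_singleton t))) {fun i : Fin w.length => w.getD i 0}
  have h2 : f ⁻¹' (({fun i : Fin w.length => w.getD i 0} : Finset (Fin w.length → ZMod 2)) : Set (Fin w.length → ZMod 2)) = cyl w := by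
    ext x
    simp only [f, cyl, Finset.coe_singleton, mem_preimage, mem_singleton_iff, funext_iff, mem_ofPred_eq]
    exact ⟨fun h i hi => h ⟨i, hi⟩, fun h i => h i i.2⟩
  rw [h2] at this
  simp at this
  rw [← ENNReal.inv_pow]
  exact ENNReal.eq_inv_of_mul_eq_one_left this

/-- the projection -/
def pp (n F : ℕ) : CS →+ TT n F :=
  { toFun := fun z => (fun i => z i, fun j i => z (F * (j + 1) + i))
    map_zero' := rfl
    map_add' := fun _ _ => rfl }

theorem pp_surj (n F : ℕ) : Function.Surjective (pp n F) := by
  rintro ⟨u, V⟩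
  refine ⟨fun t => if h : t < F then u ⟨t, h⟩ else
    if h' : t / F - 1 < n ∧ t % F < F then V ⟨t / F - 1, h'.1⟩ ⟨t % F, h'.2⟩ else 0, ?_⟩
  refine Prod.ext ?_ ?_
  · ext i
    simp [pp]
  · ext j i
    have hF : 0 < F := i.pos
    have h1 : (F * (j + 1) + i : ℕ) / F = j + 1 := by
      rw [Nat.mul_add_div hF, Nat.div_eq_of_lt i.2, add_zero]
    have h2 : (F * (j + 1) + i : ℕ) % F = i := by
      rw [Nat.mul_add_mod, Nat.mod_eq_of_lt i.2]
    have h3 : ¬ (F * (j + 1) + i : ℕ) < F := by nlinarith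
    simp [pp, h1, h3, Nat.mod_eq_of_lt i.2]

theorem pp_cont (n F : ℕ) : Continuous (pp n F) := by
  refine Continuous.prodMk ?_ ?_
  · exact continuous_pi (fun i => continuous_apply _)
  · exact continuous_pi (fun i => continuous_pi (fun j => continuous_apply _))

theorem meas_bound (n F : ℕ) (R : Set (TT n F)) (R' : Finset (TT n F)) (hR : ∀ p, p ∈ R' ↔ p ∈ R)
    (h : R'.card * 2 ^ n ≤ 2 * Fintype.card (TT n F)) :
    nu (pp n F ⁻¹' R) ≤ 2 * (2⁻¹ : ENNReal) ^ n := by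
  have := meas_fiber nu (pp n F) (pp_surj n F)
    (fun t => ((pp_cont n F).measurable (measurableSet_singleton t))) R'
  have e : (R' : Set (TT n F)) = R := by ext p; exact hR p
  rw [e] at this
  set c : ENNReal := (Fintype.card (TT n F) : ENNReal) with hc
  have hc0 : c ≠ 0 := by simp [hc]
  have hct : c ≠ ⊤ := ENNReal.natCast_ne_top _
  have h' : (R'.card : ENNReal) * 2 ^ n ≤ 2 * c := by rw [hc]; exact_mod_cast h
  rw [← this] at h'
  have h2 : nu (pp n F ⁻¹' R) * 2 ^ n ≤ 2 := by
    rw [mul_right_comm] at h'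
    exact (ENNReal.mul_le_mul_iff_left hc0 hct).1 h'
  rw [← ENNReal.inv_pow, ← div_eq_mul_inv]
  rw [ENNReal.le_div_iff_mul_le (by simp) (by simp)]
  exact h2

theorem slalom (Y : Set CS) (hNA : ∀ X : Set CS, nu X = 0 → nu (Y + X) = 0) (F : ℕ → ℕ)
    (hF : ∀ n, 3 * n ≤ F n) :
    ∃ (ι : Type) (_ : Countable ι) (Z : ι → Set CS), Y ⊆ ⋃ i, Z i ∧ ∀ i, ∀ᶠ n in Filter.atTop,
      ∀ S : Finset CS, ↑S ⊆ Z i → (∀ s ∈ S, ∀ t ∈ S, s ≠ t → ∃ j < F n, s j ≠ t j) → S.card ≠ 4 ^ n := by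
  classical
  let A : ℕ → Set CS := fun n => pp n (F n) ⁻¹' AA n (F n)
  have hA : ∀ n, nu (A n) ≤ 2 * (2⁻¹ : ENNReal) ^ n := fun n =>
    meas_bound n (F n) _ _ (by simp) (card_AA (hF n))
  have hgeo : ∑' n : ℕ, 2 * (2⁻¹ : ENNReal) ^ n ≠ ⊤ := by
    rw [ENNReal.tsum_mul_left, ENNReal.tsum_geometric]
    simp [ENNReal.mul_eq_top]
  have hH : nu (Filter.limsup A Filter.atTop) = 0 :=
    measure_limsup_atTop_eq_zero (ne_top_of_le_ne_top hgeo (ENNReal.tsum_le_tsum hA))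
  have hYH := hNA _ hH
  obtain ⟨W, hW1, hW2, hW3⟩ := exists_measurable_superset_of_null hYH
  have hWc : nu Wᶜ = 1 := by rw [prob_compl_eq_one_iff hW2]; exact hW3
  obtain ⟨K0, hK0W, hK0c, hK0m⟩ := hW2.compl.exists_isCompact_lt_add (μ := nu) (by simp [hWc])
    (ε := 1) one_ne_zero
  have hK0pos : nu K0 ≠ 0 := by
    intro h; rw [h, hWc] at hK0m; simp at hK0m
  let K := (nu.restrict K0).support
  have hKcl : IsClosed K := Measure.isClosed_support
  have hKK0 : K ⊆ K0 := Measure.support_subset_of_isClosed hK0c.isClosed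
    (self_mem_ae_restrict hK0c.measurableSet)
  have hKne : K.Nonempty := Measure.nonempty_support (by simpa using hK0pos)
  have hKpos : ∀ U : Set CS, IsOpen U → (U ∩ K).Nonempty → nu (U ∩ K) ≠ 0 := by
    rintro U hU ⟨x, hxU, hxK⟩ h0
    have h1 := (Measure.mem_support_iff_forall x).1 hxK U (hU.mem_nhds hxU)
    have h2 : (nu.restrict K0) Kᶜ = 0 := Measure.measure_compl_support
    have h3 : (nu.restrict K0) (U ∩ K) = 0 :=
      le_antisymm ((Measure.restrict_apply_le _ _).trans h0.le) bot_le
    have h4 : (nu.restrict K0) U ≤ (nu.restrict K0) (U ∩ K) + (nu.restrict K0) Kᶜ := by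
      refine (measure_mono ?_).trans (measure_union_le _ _)
      intro z hz
      by_cases hzK : z ∈ K
      · exact Or.inl ⟨hz, hzK⟩
      · exact Or.inr hzK
    rw [h2, h3, add_zero] at h4
    exact absurd h1 (not_lt.2 h4)
  let C : ℕ → CS → Set CS := fun m y => {z | ∀ n ≥ m, z - y ∉ A n}
  have hAopen : ∀ n, IsOpen (A n) := fun n => (isOpen_discrete _).preimage (pp_cont n (F n))
  have hCcl : ∀ m y, IsClosed (C m y) := by
    intro m y
    have : C m y = ⋂ n ≥ m, (fun z => z - y) ⁻¹' (A n)ᶜ := by ext; simp [C]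
    rw [this]
    refine isClosed_iInter fun n => isClosed_iInter fun _ => ?_
    exact (hAopen n).isClosed_compl.preimage (continuous_id.sub continuous_const)
  refine ⟨TopologicalSpace.countableBasis CS × ℕ, inferInstance,
    fun i => {y | ((i.1 : Set CS) ∩ K).Nonempty ∧ (i.1 : Set CS) ∩ K ⊆ C i.2 y}, ?_, ?_⟩
  · intro y hy
    have hcov : ∀ z ∈ K, ∃ m, z ∈ C m y := by
      intro z hz
      by_contra hcon
      push Not at hcon
      apply hK0W (hKK0 hz)
      apply hW1
      refine ⟨y, hy, z - y, ?_, by simp⟩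
      rw [Filter.mem_limsup_iff_frequently_mem, Filter.frequently_atTop]
      intro m
      have := hcon m
      simp only [C, mem_ofPred_eq] at this
      push Not at this
      obtain ⟨n, hn, h⟩ := this
      exact ⟨n, hn, h⟩
    have : CompactSpace K := isCompact_iff_compactSpace.1 hKcl.isCompact
    have : Nonempty K := hKne.to_subtype
    obtain ⟨m, hm⟩ := nonempty_interior_of_iUnion_of_closed (X := K) (f := fun m => Subtype.val ⁻¹' (C m y))
      (fun m => (hCcl m y).preimage continuous_subtype_val) (by
        ext z
        simpa using hcov z z.2)
    obtain ⟨z, hz⟩ := hm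
    obtain ⟨O, hO, hOe⟩ := isOpen_induced_iff.1 (isOpen_interior (s := (Subtype.val ⁻¹' (C m y) : Set K)))
    have hzO : (z : CS) ∈ O := by
      have : z ∈ (Subtype.val ⁻¹' O : Set K) := by rw [hOe]; exact hz
      exact this
    obtain ⟨B, hB, hzB, hBO⟩ := (TopologicalSpace.isBasis_countableBasis CS).exists_subset_of_mem_open hzO hO
    refine mem_iUnion.2 ⟨(⟨B, hB⟩, m), ⟨z, hzB, z.2⟩, ?_⟩
    rintro x ⟨hxB, hxK⟩
    have : (⟨x, hxK⟩ : K) ∈ (Subtype.val ⁻¹' O : Set K) := hBO hxB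
    rw [hOe] at this
    have h5 := interior_subset this
    exact h5
  · rintro ⟨⟨B, hB⟩, m⟩
    by_cases hne : (B ∩ K).Nonempty
    swap
    · refine Filter.Eventually.of_forall fun n S hS _ hcard => ?_
      have : S.Nonempty := by
        rw [← Finset.card_pos, hcard]; positivity
      obtain ⟨s, hs⟩ := this
      exact hne (hS hs).1
    have hpos := hKpos B (TopologicalSpace.isOpen_of_mem_countableBasis hB) hne
    have htend : Filter.Tendsto (fun n : ℕ => 2 * (2⁻¹ : ENNReal) ^ n) Filter.atTop (nhds 0) := by
      exact ENNReal.tendsto_atTop_zero_of_tsum_ne_top hgeo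
    have hev := htend.eventually (gt_mem_nhds (pos_iff_ne_zero.2 hpos))
    filter_upwards [hev, Filter.eventually_ge_atTop m] with n hn hmn S hS hinj hcard
    have hb := meas_bound n (F n) {z | ∀ s ∈ S, z - pp n (F n) s ∉ AA n (F n)} _ (by simp)
      (card_bad (hF n) S (fun s => pp n (F n) s) (fun s hs t ht hst h => by
        obtain ⟨j, hj, hne⟩ := hinj s hs t ht hst
        exact hne (congrFun h ⟨j, hj⟩)) hcard)
    refine absurd (measure_mono ?_) (not_le.2 (hb.trans_lt hn))
    intro z hz s hs
    have := (hS hs).2 hz n hmn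
    simpa [A] using this

theorem reps (Q : Set CS) (N k : ℕ)
    (h : ∀ S : Finset CS, ↑S ⊆ Q → (∀ s ∈ S, ∀ t ∈ S, s ≠ t → ∃ j < N, s j ≠ t j) → S.card ≠ k) :
    ∃ S : Finset CS, ↑S ⊆ Q ∧ S.card ≤ k ∧ ∀ y ∈ Q, ∃ s ∈ S, ∀ j < N, s j = y j := by
  classical
  let f : CS → (Fin N → ZMod 2) := fun x i => x i
  obtain ⟨sq, hsq, hb⟩ := Set.exists_subset_bijOn Q f
  have hfin : sq.Finite := Set.Finite.of_finite_image (Set.toFinite (f '' sq)) hb.injOn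
  have hinj : ∀ s ∈ sq, ∀ t ∈ sq, s ≠ t → ∃ j < N, s j ≠ t j := by
    intro s hs t ht hst
    by_contra hcon
    push Not at hcon
    exact hst (hb.injOn hs ht (funext fun i => hcon i i.2))
  refine ⟨hfin.toFinset, by simpa using hsq, ?_, ?_⟩
  · by_contra hcon
    obtain ⟨R, hR, hRk⟩ := Finset.exists_subset_card_eq (le_of_not_ge hcon)
    have hR' : ∀ s ∈ R, s ∈ sq := fun s hs => by simpa using hR hs
    exact h R (fun s hs => hsq (hR' s hs)) (fun s hs t ht => hinj s (hR' s hs) t (hR' t ht)) hRk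
  · intro y hy
    obtain ⟨s, hs, he⟩ := hb.surjOn (Set.mem_image_of_mem f hy)
    exact ⟨s, by simpa using hs, fun j hj => congrFun he ⟨j, hj⟩⟩

theorem gdelta_limsup (U : ℕ → Set CS) (hU : ∀ n, IsOpen (U n)) :
    ∃ C : ℕ → Set CS, (∀ j, FinDep j (C j)) ∧ ∀ x, (∀ n, x ∈ U n) ↔ ∀ N, ∃ j ≥ N, x ∈ C j := by
  classical
  let P : ℕ → ℕ → CS → Prop := fun n j x => ∀ z : CS, (∀ i < j, z i = x i) → ∀ m ≤ n, z ∈ U m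
  have hP : ∀ n j j' x x', j ≤ j' → (∀ i < j', x i = x' i) → P n j x → P n j x' := by
    intro n j j' x x' hj hx h z hz
    exact h z (fun i hi => (hz i hi).trans (hx i (by omega)).symm)
  have hP' : ∀ n j j' x, j ≤ j' → P n j x → P n j' x := by
    intro n j j' x hj h z hz
    exact h z (fun i hi => hz i (by omega))
  refine ⟨fun j => {x | ∃ n ≤ j, P n j x ∧ ∀ i, n ≤ i → i < j → ¬ P n i x}, ?_, ?_⟩
  · rintro j x z hxz ⟨n, hn, h1, h2⟩
    exact ⟨n, hn, hP n j j x z le_rfl hxz h1, fun i hi hij h =>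
      h2 i hi hij (hP n i j z x hij.le (fun i hi => (hxz i hi).symm) h)⟩
  · intro x
    constructor
    · intro hx N
      have hO : IsOpen (⋂ m ∈ Finset.range (N + 1), U m) := isOpen_biInter_finset (fun i _ => hU i)
      obtain ⟨k, hk⟩ := exists_nhd hO (x := x) (by simp [hx])
      have hPk : P N k x := by
        intro z hz m hm
        have := hk z hz
        simp only [mem_iInter, Finset.mem_range] at this
        exact this m (by omega)
      have hex : ∃ j, N ≤ j ∧ P N j x := ⟨max N k, le_max_left _ _, hP' N k _ x (le_max_right _ _) hPk⟩
      obtain ⟨h1, h2⟩ := Nat.find_spec hex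
      exact ⟨Nat.find hex, h1, N, h1, h2, fun i hi hij h => Nat.find_min hex hij ⟨hi, h⟩⟩
    · intro h
      by_contra hcon
      push Not at hcon
      obtain ⟨n0, hn0⟩ := hcon
      let e : ℕ → ℕ := fun n => if hn : ∃ j, n ≤ j ∧ P n j x then Nat.find hn else 0
      obtain ⟨j, hj, n, hn, h1, h2⟩ := h ((Finset.range n0).sup e + 1)
      have hlt : n < n0 := by
        by_contra hge
        exact hn0 (h1 x (fun _ _ => rfl) n0 (by omega))
      have hex : ∃ j, n ≤ j ∧ P n j x := ⟨j, hn, h1⟩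
      have he : e n = j := by
        simp only [e, dif_pos hex]
        rw [Nat.find_eq_iff]
        exact ⟨⟨hn, h1⟩, fun i hi h => h2 i h.1 hi h.2⟩
      have : e n ≤ (Finset.range n0).sup e := Finset.le_sup (by simpa using hlt)
      omega

theorem between (β : ℕ → ℕ) (hβ : StrictMono β) (N j : ℕ) (h : β N ≤ j) :
    ∃ n ≥ N, β n ≤ j ∧ j < β (n + 1) := by
  have hex : ∃ n, j < β n := ⟨j + 1, lt_of_lt_of_le (Nat.lt_succ_self j) (hβ.id_le _)⟩
  classical
  have h1 := Nat.find_spec hex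
  have h2 : N < Nat.find hex := by
    by_contra hcon
    have := hβ.monotone (not_lt.1 hcon)
    omega
  refine ⟨Nat.find hex - 1, by omega, ?_, ?_⟩
  · have := Nat.find_min hex (m := Nat.find hex - 1) (by omega)
    omega
  · rwa [Nat.sub_add_cancel (by omega)]

/-- Let `μ` be a finite diffused Borel measure, `G` a `G_δ` set and `Y` a
null-additive set all of whose Borel images in `ω^ω` are `≤*`-bounded. If `μ(G + y) = 0`
for every `y ∈ Y`, then `μ(G + Y) = 0`. -/
theorem stmt_18 (μ : Measure CS) (hfin : IsFiniteMeasure μ)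
    (hdiff : ∀ x : CS, μ {x} = 0) (G : Set CS) (hG : IsGδ G) (Y : Set CS)
    (hNA : ∀ ν : Measure CS, IsFairCoin ν → ∀ X : Set CS, ν X = 0 → ν (Y + X) = 0)
    (hbd : ∀ φ : ↥Y → ℕ → ℕ, Measurable φ →
      ∃ α : ℕ → ℕ, ∀ y : ↥Y, ∀ᶠ n in Filter.atTop, φ y n ≤ α n)
    (h0 : ∀ y ∈ Y, μ ((fun g => g + y) '' G) = 0) :
    μ (G + Y) = 0 := by
  classical
  obtain ⟨U, hU, rfl⟩ := hG.eq_iInter_nat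
  obtain ⟨C, hC, hGC⟩ := gdelta_limsup U hU
  let T : ℕ → Set CS := fun N => {x | ∃ j ≥ N, x ∈ C j}
  have hTopen : ∀ N, IsOpen (T N) := by
    intro N
    have : T N = ⋃ j ≥ N, C j := by ext; simp [T]
    rw [this]
    exact isOpen_iUnion fun j => isOpen_iUnion fun _ => (hC j).isOpen
  have hTanti : ∀ N N', N ≤ N' → T N' ⊆ T N := by
    rintro N N' h x ⟨j, hj, hx⟩
    exact ⟨j, le_trans h hj, hx⟩
  have hpre : ∀ (y : CS) (W : Set CS), IsOpen W → MeasurableSet {z : CS | z - y ∈ W} := fun y W hW =>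
    (hW.preimage (continuous_id.sub continuous_const)).measurableSet
  have hex : ∀ (y : ↥Y) (n : ℕ), ∃ N, μ {z : CS | z - (y : CS) ∈ T N} < (8⁻¹ : ENNReal) ^ n := by
    intro y n
    have ht := tendsto_measure_iInter_atTop (μ := μ) (s := fun N => {z : CS | z - (y : CS) ∈ T N})
      (fun N => (hpre y _ (hTopen N)).nullMeasurableSet) (fun N N' h z hz => hTanti N N' h hz)
      ⟨0, measure_ne_top _ _⟩
    have he : (⋂ N, {z : CS | z - (y : CS) ∈ T N}) = (fun g => g + (y : CS)) '' (⋂ n, U n) := by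
      ext z
      simp only [mem_iInter, mem_image]
      constructor
      · intro h
        exact ⟨z - y, fun n => (hGC _).2 h n, by simp⟩
      · rintro ⟨g, hg, rfl⟩ N
        have := (hGC g).1 hg N
        simpa [T] using this
    rw [he, h0 y y.2] at ht
    have h8 : (0 : ENNReal) < (8⁻¹ : ENNReal) ^ n := ENNReal.pow_pos (by simp) n
    exact (ht.eventually (gt_mem_nhds h8)).exists
  obtain ⟨α, hα⟩ := hbd (fun y n => Nat.find (hex y n)) (by
    rw [measurable_pi_iff]
    intro n
    apply measurable_find
    intro N
    have hs : MeasurableSet {p : CS × CS | p.2 - p.1 ∈ T N} :=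
      ((hTopen N).preimage (continuous_snd.sub continuous_fst)).measurableSet
    have hm := (measurable_measure_prodMk_left (ν := μ) hs).comp (measurable_subtype_coe (p := fun y => y ∈ Y))
    exact measurableSet_lt hm measurable_const)
  let β : ℕ → ℕ := fun n => 3 * n + ∑ i ∈ Finset.range (n + 1), α i
  have hβ : StrictMono β := strictMono_nat_of_lt_succ (fun n => by
    simp only [β]
    rw [Finset.sum_range_succ _ (n + 1)]
    omega)
  have hαβ : ∀ n, α n ≤ β n := fun n => by
    simp only [β]
    rw [Finset.sum_range_succ]
    omega
  let D : ℕ → Set CS := fun n => {x | ∃ j, β n ≤ j ∧ j < β (n + 1) ∧ x ∈ C j}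
  have hD : ∀ n, FinDep (β (n + 1)) (D n) := by
    rintro n x z hxz ⟨j, h1, h2, h3⟩
    exact ⟨j, h1, h2, hC j x z (fun i hi => hxz i (by omega)) h3⟩
  have hDsmall : ∀ y ∈ Y, ∃ m, ∀ n ≥ m, μ {z : CS | z - y ∈ D n} ≤ (8⁻¹ : ENNReal) ^ n := by
    intro y hy
    obtain ⟨m, hm⟩ := Filter.eventually_atTop.1 (hα ⟨y, hy⟩)
    refine ⟨m, fun n hn => ?_⟩
    refine le_trans (measure_mono ?_) (Nat.find_spec (hex ⟨y, hy⟩ n)).le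
    rintro z ⟨j, h1, h2, h3⟩
    exact ⟨j, ((hm n hn).trans (hαβ n)).trans h1, h3⟩
  have hGD : ∀ g ∈ ⋂ n, U n, ∀ N, ∃ n ≥ N, g ∈ D n := by
    intro g hg N
    obtain ⟨j, hj, hgj⟩ := (hGC g).1 (by simpa using hg) (β N)
    obtain ⟨n, hn, h1, h2⟩ := between β hβ N j hj
    exact ⟨n, hn, j, h1, h2, hgj⟩
  obtain ⟨ι, hι, Z, hYZ, hZ⟩ := slalom Y (hNA nu nu_fair) (fun n => β (n + 1)) (fun n => by
    simp only [β]; omega)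
  let Q : ι → ℕ → Set CS := fun i m => {y | y ∈ Z i ∧ ∀ n ≥ m, μ {z : CS | z - y ∈ D n} ≤ (8⁻¹ : ENNReal) ^ n}
  let L : ι → ℕ → Set CS := fun i m => {z | ∀ N, ∃ n ≥ N, ∃ y ∈ Q i m, z - y ∈ D n}
  have hcover : (⋂ n, U n) + Y ⊆ ⋃ i, ⋃ m, L i m := by
    rintro _ ⟨g, hg, y, hy, rfl⟩
    obtain ⟨i, hi⟩ := mem_iUnion.1 (hYZ hy)
    obtain ⟨m, hm⟩ := hDsmall y hy
    refine mem_iUnion.2 ⟨i, mem_iUnion.2 ⟨m, fun N => ?_⟩⟩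
    obtain ⟨n, hn, h⟩ := hGD g hg N
    exact ⟨n, hn, y, ⟨hi, hm⟩, by simpa using h⟩
  refine measure_mono_null hcover (measure_iUnion_null fun i => measure_iUnion_null fun m => ?_)
  obtain ⟨N0, hN0⟩ := Filter.eventually_atTop.1 (hZ i)
  let E : ℕ → Set CS := fun n => if N0 ≤ n ∧ m ≤ n then {z | ∃ y ∈ Q i m, z - y ∈ D n} else ∅
  have hE : ∀ n, μ (E n) ≤ (2⁻¹ : ENNReal) ^ n := by
    intro n
    simp only [E]
    split_ifs with hn
    swap
    · simp
    obtain ⟨S, hSQ, hSk, hS⟩ := reps (Q i m) (β (n + 1)) (4 ^ n)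
      (fun S hS => hN0 n hn.1 S (fun s hs => (hS hs).1))
    have hsub : {z : CS | ∃ y ∈ Q i m, z - y ∈ D n} ⊆ ⋃ s ∈ S, {z : CS | z - s ∈ D n} := by
      rintro z ⟨y, hy, hz⟩
      obtain ⟨s, hs, hsy⟩ := hS y hy
      refine mem_biUnion hs ?_
      exact hD n (z - y) (z - s) (fun j hj => by simp [hsy j hj]) hz
    calc μ {z : CS | ∃ y ∈ Q i m, z - y ∈ D n} ≤ μ (⋃ s ∈ S, {z : CS | z - s ∈ D n}) := measure_mono hsub
      _ ≤ ∑ s ∈ S, μ {z : CS | z - s ∈ D n} := measure_biUnion_finset_le _ _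
      _ ≤ ∑ s ∈ S, (8⁻¹ : ENNReal) ^ n := Finset.sum_le_sum fun s hs => (hSQ hs).2 n hn.2
      _ = S.card * (8⁻¹ : ENNReal) ^ n := by simp
      _ ≤ (4 : ENNReal) ^ n * (8⁻¹ : ENNReal) ^ n := by
          gcongr
          exact_mod_cast hSk
      _ = (2⁻¹ : ENNReal) ^ n := by
          rw [← mul_pow]
          congr 1
          have h8 : (8 : ENNReal) = 4 * 2 := by norm_num
          rw [h8, ENNReal.mul_inv (by simp) (by simp), ← mul_assoc, ENNReal.mul_inv_cancel (by simp) (by simp),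
            one_mul]
  have hlim : μ (Filter.limsup E Filter.atTop) = 0 := by
    apply measure_limsup_atTop_eq_zero
    refine ne_top_of_le_ne_top ?_ (ENNReal.tsum_le_tsum hE)
    rw [ENNReal.tsum_geometric]
    simp
  refine measure_mono_null ?_ hlim
  intro z hz
  rw [Filter.mem_limsup_iff_frequently_mem, Filter.frequently_atTop]
  intro N
  obtain ⟨n, hn, h⟩ := hz (max N (max N0 m))
  refine ⟨n, by omega, ?_⟩
  simp only [E]
  rw [if_pos (by omega)]
  exact h
end
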